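/- arXiv:2107.06385 — 3 statements merged into one kernel-verified Lean document; each statement's English description precedes it below -/
import Mathlib

section
/- The group Aut(P_λ) is the free product of its subgroups A and T amalgamated over C = A ∩ T: the canonical group homomorphism from the amalgamated free product A *_C T (the pushout of the inclusion homomorphisms C → A and C → T) to Aut(P_λ), induced by the inclusions of A and T into Aut(P_λ), is a group isomorphism. -/
noncomputable section

open scoped Pointwise

variable (K : Type*) [Field K] [IsAlgClosed K] [CharZero K] (lam : K)

/-- `P_λ`: the quotient of `K[X,Y,Z]` by the ideal generated by `4XZ + Y² - λ`. -/
abbrev PQ : Type _ :=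
  MvPolynomial (Fin 3) K ⧸
    Ideal.span {4 * MvPolynomial.X 0 * MvPolynomial.X 2 + MvPolynomial.X 1 ^ 2 -
      MvPolynomial.C lam}

/-- `e`, the image of `X`. -/
def pe : PQ K lam := Ideal.Quotient.mk _ (MvPolynomial.X 0)

/-- `h`, the image of `Y`. -/
def ph : PQ K lam := Ideal.Quotient.mk _ (MvPolynomial.X 1)

/-- `f`, the image of `Z`. -/
def pf : PQ K lam := Ideal.Quotient.mk _ (MvPolynomial.X 2)

/-- A Poisson bracket on `P_λ`: a `K`-bilinear Lie bracket satisfying the Leibniz rule with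
`{e,f} = h`, `{h,e} = 2e`, `{h,f} = -2f`. -/
structure PoissonBr : Type _ where
  br : PQ K lam → PQ K lam → PQ K lam
  add_left : ∀ a b c, br (a + b) c = br a c + br b c
  add_right : ∀ a b c, br a (b + c) = br a b + br a c
  smul_left : ∀ (μ : K) (a b), br (μ • a) b = μ • br a b
  smul_right : ∀ (μ : K) (a b), br a (μ • b) = μ • br a b
  alternate : ∀ a, br a a = 0
  jacobi : ∀ a b c, br a (br b c) + br b (br c a) + br c (br a b) = 0
  leibniz : ∀ a b c, br a (b * c) = b * br a c + br a b * c
  br_ef : br (pe K lam) (pf K lam) = ph K lam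
  br_he : br (ph K lam) (pe K lam) = 2 * pe K lam
  br_hf : br (ph K lam) (pf K lam) = -2 * pf K lam

variable {K lam}

/-- `Aut(P_λ)`: the subgroup of `K`-algebra automorphisms of `P_λ` preserving the bracket.
Multiplication is composition: `(θ * φ) x = θ (φ x)`. -/
def PAut (B : PoissonBr K lam) : Subgroup ((PQ K lam) ≃ₐ[K] (PQ K lam)) where
  carrier := {φ | ∀ a b, φ (B.br a b) = B.br (φ a) (φ b)}
  one_mem' := fun _ _ => rfl
  mul_mem' := by
    intro φ ψ hφ hψ a b
    show φ (ψ (B.br a b)) = _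
    rw [hψ, hφ]
    rfl
  inv_mem' := by
    intro φ hφ a b
    apply φ.injective
    show φ (φ.symm (B.br a b)) = φ (B.br (φ.symm a) (φ.symm b))
    rw [hφ]
    simp

/-- `D` is the automorphism `Δ_g`:
`e ↦ e − g(f)h − f·g(f)²`, `h ↦ h + 2f·g(f)`, `f ↦ f`. -/
def IsDelta (B : PoissonBr K lam) (g : Polynomial K) (D : ↥(PAut B)) : Prop :=
  D.val (pe K lam) =
      pe K lam - Polynomial.aeval (pf K lam) g * ph K lam -
        pf K lam * Polynomial.aeval (pf K lam) g ^ 2 ∧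
  D.val (ph K lam) = ph K lam + 2 * (pf K lam * Polynomial.aeval (pf K lam) g) ∧
  D.val (pf K lam) = pf K lam

/-- `D` is the automorphism `τ`: `e ↦ f`, `h ↦ -h`, `f ↦ e`. -/
def IsTau (B : PoissonBr K lam) (D : ↥(PAut B)) : Prop :=
  D.val (pe K lam) = pf K lam ∧ D.val (ph K lam) = -ph K lam ∧ D.val (pf K lam) = pe K lam

/-- `D` is the automorphism `τ_α`: `e ↦ f`, `h ↦ -h + 2αf`, `f ↦ e + αh - α²f`. -/
def IsTauA (B : PoissonBr K lam) (α : K) (D : ↥(PAut B)) : Prop :=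
  D.val (pe K lam) = pf K lam ∧
  D.val (ph K lam) = -ph K lam + (2 * α) • pf K lam ∧
  D.val (pf K lam) = pe K lam + α • ph K lam - α ^ 2 • pf K lam

/-- `D` is the hyperbolic rotation `H_β`: `e ↦ βe`, `h ↦ h`, `f ↦ β⁻¹f`. -/
def IsHRot (B : PoissonBr K lam) (β : Kˣ) (D : ↥(PAut B)) : Prop :=
  D.val (pe K lam) = (β : K) • pe K lam ∧
  D.val (ph K lam) = ph K lam ∧
  D.val (pf K lam) = (β : K)⁻¹ • pf K lam

/-- The set `C` of linear triangular automorphisms: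
`e ↦ βe + αh − (α²/β)f`, `h ↦ h − (2α/β)f`, `f ↦ β⁻¹f` with `α ∈ K`, `β ∈ Kˣ`. -/
def CsetLT (B : PoissonBr K lam) : Set ↥(PAut B) :=
  {D | ∃ (α : K) (β : Kˣ),
    D.val (pe K lam) = (β : K) • pe K lam + α • ph K lam - (α ^ 2 / (β : K)) • pf K lam ∧
    D.val (ph K lam) = ph K lam - (2 * α / (β : K)) • pf K lam ∧
    D.val (pf K lam) = (β : K)⁻¹ • pf K lam}

/-- The subgroup `A ⊆ Aut(P_λ)` of linear automorphisms: automorphisms preserving the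
`K`-linear span of `{e, h, f}`. -/
def Asub (B : PoissonBr K lam) : Subgroup ↥(PAut B) where
  carrier := {D | D.val ''
      ((Submodule.span K {pe K lam, ph K lam, pf K lam} : Submodule K (PQ K lam)) : Set (PQ K lam)) =
      ((Submodule.span K {pe K lam, ph K lam, pf K lam} : Submodule K (PQ K lam)) : Set (PQ K lam))}
  one_mem' := by
    show (1 : (PQ K lam) ≃ₐ[K] (PQ K lam)) '' _ = _
    rw [show ⇑(1 : (PQ K lam) ≃ₐ[K] (PQ K lam)) = id from rfl, Set.image_id]
  mul_mem' := by
    intro a b ha hb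
    show (a.val * b.val) '' _ = _
    rw [show ⇑(a.val * b.val) = ⇑a.val ∘ ⇑b.val from rfl, Set.image_comp]
    rw [Set.mem_setOf_eq] at ha hb
    rw [hb, ha]
  inv_mem' := by
    intro a ha
    rw [Set.mem_setOf_eq] at ha ⊢
    conv_lhs => rw [← ha]
    show a.val.symm '' (a.val '' _) = _
    rw [← Set.image_comp]
    rw [show ⇑a.val.symm ∘ ⇑a.val = id from funext fun x => a.val.symm_apply_apply x, Set.image_id]

variable (B : PoissonBr K lam)

/-- The subgroup `T` of triangular automorphisms, generated by `J = {Δ_g}` and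
`H = {H_β}`. -/
def Tsub (Δ : Polynomial K → ↥(PAut B)) (HR : Kˣ → ↥(PAut B)) : Subgroup ↥(PAut B) :=
  Subgroup.closure (Set.range Δ ∪ Set.range HR)

/-- The pair of groups `A` and `T` (indexed by `Bool`). -/
def amalgFam (Δ : Polynomial K → ↥(PAut B)) (HR : Kˣ → ↥(PAut B)) : Bool → Type _ :=
  fun i => Bool.rec (↥(Tsub B Δ HR)) (↥(Asub B)) i

instance (Δ : Polynomial K → ↥(PAut B)) (HR : Kˣ → ↥(PAut B)) (i : Bool) :
    Group (amalgFam B Δ HR i) := by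
  cases i <;> dsimp [amalgFam] <;> infer_instance

/-- The inclusions of `C = A ⊓ T` into `A` and `T`. -/
def amalgIncl (Δ : Polynomial K → ↥(PAut B)) (HR : Kˣ → ↥(PAut B)) :
    ∀ i : Bool, ↥(Asub B ⊓ Tsub B Δ HR) →* amalgFam B Δ HR i :=
  fun i => Bool.rec (Subgroup.inclusion inf_le_right) (Subgroup.inclusion inf_le_left) i

/-- The inclusions of `A` and `T` into `Aut(P_λ)`. -/
def amalgToAut (Δ : Polynomial K → ↥(PAut B)) (HR : Kˣ → ↥(PAut B)) :
    ∀ i : Bool, amalgFam B Δ HR i →* ↥(PAut B) :=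
  fun i => Bool.rec (Tsub B Δ HR).subtype (Asub B).subtype i

set_option linter.unusedSectionVars false

section

open Polynomial

/-- Laurent polynomials in `T` with coefficients in `K[X]`. -/
abbrev Lau (K : Type*) [Field K] : Type _ := LaurentPolynomial K[X]

namespace Lau

open AddMonoidAlgebra

/-- A linear endomorphism satisfying the Leibniz rule on monomials `p T^m` is a derivation. -/
def derivationOfSingle (D : Lau K →ₗ[K] Lau K)
    (hD : ∀ (m n : ℤ) (p q : K[X]), D (single (m + n) (p * q)) =
      single m p * D (single n q) + single n q * D (single m p)) :
    Derivation K (Lau K) (Lau K) :=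
  Derivation.mk' D (by
    intro A B
    induction A using AddMonoidAlgebra.induction_linear with
    | zero => simp
    | add A A' h h' => simp only [add_mul, map_add, h, h', add_smul, smul_add]; abel
    | single m p =>
      induction B using AddMonoidAlgebra.induction_linear with
      | zero => simp
      | add A A' h h' => simp only [mul_add, map_add, h, h', add_smul, smul_add]; abel
      | single n q => simpa only [single_mul_single, smul_eq_mul] using hD m n p q)

/-- The coefficientwise derivative with respect to `X`, as a linear map. -/
def dXLin : Lau K →ₗ[K] Lau K where
  toFun A := .ofCoeff (A.coeff.mapRange derivative (map_zero _))
  map_add' A B := by ext1 w; simp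
  map_smul' c A := by ext1 w; simp

/-- The Euler operator `T ∂/∂T`, as a linear map. -/
def eulerLin : Lau K →ₗ[K] Lau K where
  toFun A := .ofCoeff
    (Finsupp.onFinset A.coeff.support (fun w => (w : K[X]) * A.coeff w)
      (fun w h => by simp only [Finsupp.mem_support_iff]; exact right_ne_zero_of_mul h))
  map_add' A B := by ext1 w; simp [mul_add]
  map_smul' c A := by ext1 w; simp

theorem coeff_single_eq (m w : ℤ) (p : K[X]) :
    (single m p : Lau K).coeff w = if m = w then p else 0 := by
  rw [coeff_single, Finsupp.single_apply]

theorem dXLin_single (m : ℤ) (p : K[X]) :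
    dXLin (single m p : Lau K) = single m (derivative p) := by
  ext1 w
  show derivative ((single m p : Lau K).coeff w) = _
  rw [coeff_single_eq, coeff_single_eq]
  split_ifs <;> simp

theorem eulerLin_single (m : ℤ) (p : K[X]) :
    eulerLin (single m p : Lau K) = single m (m * p) := by
  ext1 w
  simp only [eulerLin, LinearMap.coe_mk, AddHom.coe_mk, coeff_ofCoeff, Finsupp.onFinset_apply,
    coeff_single_eq]
  split_ifs with h
  · rw [h]
  · simp

/-- The coefficientwise derivative with respect to `X`. -/
def dX : Derivation K (Lau K) (Lau K) :=
  derivationOfSingle dXLin (by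
    intro m n p q
    rw [dXLin_single, dXLin_single, dXLin_single, single_mul_single, single_mul_single,
      add_comm n m, ← single_add, derivative_mul]
    congr 1; ring)

/-- The Euler derivation `T ∂/∂T`. -/
def euler : Derivation K (Lau K) (Lau K) :=
  derivationOfSingle eulerLin (by
    intro m n p q
    rw [eulerLin_single, eulerLin_single, eulerLin_single, single_mul_single, single_mul_single,
      add_comm n m, ← single_add]
    congr 1; push_cast; ring)

theorem dX_single (m : ℤ) (p : K[X]) : dX (single m p : Lau K) = single m (derivative p) :=
  dXLin_single m p

theorem euler_single (m : ℤ) (p : K[X]) : euler (single m p : Lau K) = single m (m * p) :=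
  eulerLin_single m p

theorem coeff_dX (A : Lau K) (w : ℤ) : (dX A).coeff w = derivative (A.coeff w) := by
  show (dXLin A).coeff w = _
  simp [dXLin]

theorem coeff_euler (A : Lau K) (w : ℤ) : (euler A).coeff w = (w : K[X]) * A.coeff w := by
  show (eulerLin A).coeff w = _
  simp [eulerLin]

/-- The Poisson derivation on Laurent polynomials for which `{X T^r, T^α} = -2 T^α`. -/
def poisson (α r : ℤ) (A : Lau K) : Derivation K (Lau K) (Lau K) :=
  (single (-r) (C (-2 / (α : K))) : Lau K) • (dX A • euler - euler A • dX)

theorem poisson_apply (α r : ℤ) (A B : Lau K) :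
    poisson α r A B =
      single (-r) (C (-2 / (α : K))) * (dX A * euler B - euler A * dX B) := by
  simp [poisson]

/-- All coefficients of `A` above `W` vanish. -/
def TopLE (A : Lau K) (W : ℤ) : Prop := ∀ w, W < w → A.coeff w = 0

theorem exists_topLE {A : Lau K} (hA : A ≠ 0) : ∃ W, TopLE A W ∧ A.coeff W ≠ 0 := by
  have hne : A.coeff.support.Nonempty := by
    rw [Finsupp.support_nonempty_iff]
    simpa using hA
  refine ⟨A.coeff.support.max' hne, fun w hw => ?_, ?_⟩
  · by_contra h
    exact absurd (Finset.le_max' _ w (Finsupp.mem_support_iff.2 h)) (not_le.2 hw)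
  · exact Finsupp.mem_support_iff.1 (Finset.max'_mem _ hne)

theorem TopLE.mono {A : Lau K} {W W' : ℤ} (hA : TopLE A W) (h : W ≤ W') : TopLE A W' :=
  fun w hw => hA w (lt_of_le_of_lt h hw)

theorem TopLE.le {A : Lau K} {W w : ℤ} (hA : TopLE A W) (h : A.coeff w ≠ 0) : w ≤ W := by
  by_contra hw
  exact h (hA w (not_le.1 hw))

theorem TopLE.add {A B : Lau K} {W : ℤ} (hA : TopLE A W) (hB : TopLE B W) : TopLE (A + B) W :=
  fun w hw => by simp [hA w hw, hB w hw]

theorem TopLE.sub {A B : Lau K} {W : ℤ} (hA : TopLE A W) (hB : TopLE B W) : TopLE (A - B) W :=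
  fun w hw => by simp [hA w hw, hB w hw]

theorem TopLE.smul {A : Lau K} {W : ℤ} (c : K) (hA : TopLE A W) : TopLE (c • A) W :=
  fun w hw => by simp [hA w hw]

theorem topLE_single (m : ℤ) (p : K[X]) : TopLE (single m p : Lau K) m :=
  fun w hw => by rw [coeff_single_eq, if_neg hw.ne]

theorem TopLE.dX {A : Lau K} {W : ℤ} (hA : TopLE A W) : TopLE (dX A) W :=
  fun w hw => by simp [coeff_dX, hA w hw]

theorem TopLE.euler {A : Lau K} {W : ℤ} (hA : TopLE A W) : TopLE (euler A) W :=
  fun w hw => by simp [coeff_euler, hA w hw]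

theorem TopLE.mul {A B : Lau K} {W w : ℤ} (hA : TopLE A W) (hB : TopLE B w) :
    TopLE (A * B) (W + w) := by
  intro v hv
  rw [AddMonoidAlgebra.coeff_mul]
  refine Finset.sum_eq_zero fun i hi => Finset.sum_eq_zero fun j hj => if_neg ?_
  rintro rfl
  have h1 := hA.le (Finsupp.mem_support_iff.1 hi)
  have h2 := hB.le (Finsupp.mem_support_iff.1 hj)
  omega

theorem TopLE.coeff_mul {A B : Lau K} {W w : ℤ} (hA : TopLE A W) (hB : TopLE B w) :
    (A * B).coeff (W + w) = A.coeff W * B.coeff w := by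
  rw [AddMonoidAlgebra.coeff_mul, Finsupp.sum, Finset.sum_eq_single W, Finsupp.sum,
    Finset.sum_eq_single w]
  · simp
  · intro j hj hjw
    exact if_neg fun h => hjw (by omega)
  · intro h
    simp [Finsupp.notMem_support_iff.1 h]
  · intro i hi hiW
    refine Finset.sum_eq_zero fun j hj => if_neg fun h => hiW ?_
    have h1 := hA.le (Finsupp.mem_support_iff.1 hi)
    have h2 := hB.le (Finsupp.mem_support_iff.1 hj)
    omega
  · intro h
    simp [Finsupp.notMem_support_iff.1 h]

theorem topLE_poisson {A B : Lau K} {W w : ℤ} (α r : ℤ) (hA : TopLE A W) (hB : TopLE B w) :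
    TopLE (poisson α r A B) (-r + (W + w)) := by
  rw [poisson_apply]
  exact (topLE_single _ _).mul ((hA.dX.mul hB.euler).sub (hA.euler.mul hB.dX))

theorem coeff_poisson {A B : Lau K} {W w : ℤ} (α r : ℤ) (hA : TopLE A W) (hB : TopLE B w) :
    (poisson α r A B).coeff (-r + (W + w)) = C (-2 / (α : K)) *
      (derivative (A.coeff W) * (w * B.coeff w) - W * A.coeff W * derivative (B.coeff w)) := by
  rw [poisson_apply,
    (topLE_single _ _).coeff_mul ((hA.dX.mul hB.euler).sub (hA.euler.mul hB.dX)),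
    AddMonoidAlgebra.coeff_sub, Finsupp.sub_apply, hA.dX.coeff_mul hB.euler, hA.euler.coeff_mul hB.dX]
  rw [coeff_single_eq, if_pos rfl, coeff_dX, coeff_dX, coeff_euler, coeff_euler]

/-- If iterating `{A, ·}` annihilates `B`, the vanishing orders at `c` of the top coefficients
of `A` and `B` satisfy an arithmetic relation. -/
theorem order_relation {α r : ℤ} (hα : α ≠ 0) {A : Lau K} {W : ℤ} (hA : TopLE A W) {c : K}
    {μ : ℕ} {φ : K[X]} (hφ : φ.eval c ≠ 0) (hAW : A.coeff W = (X - C c) ^ (μ + 1) * φ)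
    (k : ℕ) : ∀ {B : Lau K} {w : ℤ} {ν : ℕ} {ψ : K[X]}, TopLE B w → ψ.eval c ≠ 0 →
      B.coeff w = (X - C c) ^ ν * ψ → (poisson α r A)^[k] B = 0 →
      ∃ j : ℕ, ((μ + 1 : ℕ) : ℤ) * w - W * ν + j * (W - r * ((μ + 1 : ℕ) : ℤ)) = 0 := by
  induction k with
  | zero =>
    intro B w ν ψ hB hψ hBw h0
    exfalso
    rw [Function.iterate_zero, id] at h0
    rw [h0] at hBw
    have h1 : (X - C c) ^ ν * ψ = 0 := hBw.symm
    rcases mul_eq_zero.1 h1 with h | h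
    · exact pow_ne_zero ν (X_sub_C_ne_zero c) h
    · simp [h] at hψ
  | succ k ih =>
    intro B w ν ψ hB hψ hBw h0
    by_cases hz : ((μ + 1 : ℕ) : ℤ) * w - W * ν = 0
    · exact ⟨0, by simpa using hz⟩
    have hα' : (α : K) ≠ 0 := by exact_mod_cast hα
    have hB' := topLE_poisson α r hA hB
    have hc := coeff_poisson α r hA hB
    have key : (poisson α r A B).coeff (-r + (W + w)) = (X - C c) ^ (ν + μ) *
        (C (-2 / (α : K)) *
          ((w : K[X]) * (((μ : K[X]) + 1) * φ + (X - C c) * derivative φ) * ψ -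
            (W : K[X]) * φ * ((ν : K[X]) * ψ + (X - C c) * derivative ψ))) := by
      rw [hc, hAW, hBw]
      rcases ν with _ | ν
      · simp only [derivative_mul, derivative_X_sub_C_pow, Nat.add_sub_cancel]
        simp
        ring
      · simp only [derivative_mul, derivative_X_sub_C_pow, Nat.add_sub_cancel]
        simp
        ring
    obtain ⟨j, hj⟩ := ih hB' (by
      have h2 : ((((μ + 1 : ℕ) : ℤ) * w - W * ν : ℤ) : K) ≠ 0 := by exact_mod_cast hz
      simp only [eval_mul, eval_sub, eval_add, eval_C, eval_X, sub_self, zero_mul, add_zero,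
        eval_intCast, eval_natCast, eval_one]
      have : (w : K) * (((μ : K) + 1) * φ.eval c) * ψ.eval c -
          W * φ.eval c * (ν * ψ.eval c) =
          ((((μ + 1 : ℕ) : ℤ) * w - W * ν : ℤ) : K) * φ.eval c * ψ.eval c := by
        push_cast; ring
      rw [this]
      exact mul_ne_zero (div_ne_zero (by norm_num) hα') (mul_ne_zero (mul_ne_zero h2 hφ) hψ))
      key h0
    refine ⟨j + 1, ?_⟩
    rw [← hj]
    push_cast
    ring

end Lau

end

section

open Polynomial

theorem PQ.rel : 4 * pe K lam * pf K lam + ph K lam ^ 2 = algebraMap K (PQ K lam) lam := by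
  rw [← sub_eq_zero]
  exact Ideal.Quotient.eq_zero_iff_mem.2 (Ideal.subset_span rfl)

/-- Induction on `P_λ` as a `K`-algebra generated by `e`, `h`, `f`. -/
theorem PQ.induction {p : PQ K lam → Prop} (hC : ∀ c : K, p (algebraMap K _ c))
    (hadd : ∀ F G, p F → p G → p (F + G)) (he : ∀ F, p F → p (F * pe K lam))
    (hh : ∀ F, p F → p (F * ph K lam)) (hf : ∀ F, p F → p (F * pf K lam)) (F : PQ K lam) : p F := by
  obtain ⟨F, rfl⟩ := Ideal.Quotient.mk_surjective F
  induction F using MvPolynomial.induction_on with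
  | C c => exact hC c
  | add F G hF hG => rw [map_add]; exact hadd _ _ hF hG
  | mul_X F i hF =>
    rw [map_mul]
    fin_cases i
    · exact he _ hF
    · exact hh _ hF
    · exact hf _ hF

/-- The algebra homomorphism out of `P_λ` with prescribed images of `e`, `h`, `f`. -/
def PQ.lift {S : Type*} [CommRing S] [Algebra K S] (x y z : S)
    (h : 4 * x * z + y ^ 2 = algebraMap K S lam) : PQ K lam →ₐ[K] S :=
  Ideal.Quotient.liftₐ _ (MvPolynomial.aeval ![x, y, z]) (by
    intro a ha
    have : Ideal.span {4 * MvPolynomial.X 0 * MvPolynomial.X 2 + MvPolynomial.X 1 ^ 2 -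
        MvPolynomial.C lam} ≤ RingHom.ker (MvPolynomial.aeval (R := K) ![x, y, z]).toRingHom := by
      rw [Ideal.span_le, Set.singleton_subset_iff]
      simp [RingHom.mem_ker, h]
    exact this ha)

section lift

variable {S : Type*} [CommRing S] [Algebra K S] {x y z : S}
  (h : 4 * x * z + y ^ 2 = algebraMap K S lam)

theorem PQ.lift_pe : PQ.lift x y z h (pe K lam) = x := by
  show MvPolynomial.aeval ![x, y, z] (MvPolynomial.X 0) = x
  simp

theorem PQ.lift_ph : PQ.lift x y z h (ph K lam) = y := by
  show MvPolynomial.aeval ![x, y, z] (MvPolynomial.X 1) = y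
  simp

theorem PQ.lift_pf : PQ.lift x y z h (pf K lam) = z := by
  show MvPolynomial.aeval ![x, y, z] (MvPolynomial.X 2) = z
  simp

theorem PQ.algHom_ext {ι κ : PQ K lam →ₐ[K] S} (he : ι (pe K lam) = κ (pe K lam))
    (hh : ι (ph K lam) = κ (ph K lam)) (hf : ι (pf K lam) = κ (pf K lam)) : ι = κ := by
  ext F
  induction F using PQ.induction with
  | hC c => simp
  | hadd F G hF hG => rw [map_add, map_add, hF, hG]
  | he F hF => rw [map_mul, map_mul, hF, he]
  | hh F hF => rw [map_mul, map_mul, hF, hh]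
  | hf F hF => rw [map_mul, map_mul, hF, hf]

/-- Two derivations along an algebra homomorphism agree if they agree on `e`, `h`, `f`. -/
theorem PQ.derivation_ext (ι : PQ K lam →ₐ[K] S) {d d' : PQ K lam →ₗ[K] S}
    (hd : ∀ a b, d (a * b) = ι a * d b + ι b * d a)
    (hd' : ∀ a b, d' (a * b) = ι a * d' b + ι b * d' a)
    (he : d (pe K lam) = d' (pe K lam)) (hh : d (ph K lam) = d' (ph K lam))
    (hf : d (pf K lam) = d' (pf K lam)) (F : PQ K lam) : d F = d' F := by
  have h1 : d 1 = 0 := by simpa using hd 1 1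
  have h1' : d' 1 = 0 := by simpa using hd' 1 1
  induction F using PQ.induction with
  | hC c => simp [Algebra.algebraMap_eq_smul_one, h1, h1']
  | hadd F G hF hG => rw [map_add, map_add, hF, hG]
  | he F hF => rw [hd, hd', hF, he]
  | hh F hF => rw [hd, hd', hF, hh]
  | hf F hF => rw [hd, hd', hF, hf]

end lift

namespace PoissonBr

variable (B : PoissonBr K lam)

/-- The Hamiltonian derivation `{a, ·}`. -/
def der (a : PQ K lam) : Derivation K (PQ K lam) (PQ K lam) :=
  Derivation.mk' ⟨⟨B.br a, B.add_right a⟩, fun μ b => B.smul_right μ a b⟩ (by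
    intro b c
    show B.br a (b * c) = b • B.br a c + c • B.br a b
    rw [B.leibniz, smul_eq_mul, smul_eq_mul, mul_comm c])

theorem der_apply (a b : PQ K lam) : B.der a b = B.br a b := rfl

theorem antisymm (a b : PQ K lam) : B.br a b = -B.br b a := by
  have h := B.alternate (a + b)
  rw [B.add_left, B.add_right, B.add_right, B.alternate, B.alternate] at h
  linear_combination h

theorem br_pf_pe : B.br (pf K lam) (pe K lam) = -ph K lam := by rw [B.antisymm, B.br_ef]

theorem br_pf_ph : B.br (pf K lam) (ph K lam) = 2 * pf K lam := by
  rw [B.antisymm, B.br_hf]; ring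

theorem br_pe_ph : B.br (pe K lam) (ph K lam) = -2 * pe K lam := by
  rw [B.antisymm, B.br_he]; ring

/-- An algebra homomorphism which is compatible with brackets on the pairs of generators is
compatible with brackets. -/
theorem map_br {S : Type*} [CommRing S] [Algebra K S] (ι : PQ K lam →ₐ[K] S)
    (β : S → Derivation K S S) (hβ : ∀ x y, β x y = -β y x) (hβ0 : ∀ x, β x x = 0)
    (hef : ι (ph K lam) = β (ι (pe K lam)) (ι (pf K lam)))
    (hhe : 2 * ι (pe K lam) = β (ι (ph K lam)) (ι (pe K lam)))
    (hhf : -2 * ι (pf K lam) = β (ι (ph K lam)) (ι (pf K lam))) (a b : PQ K lam) :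
    ι (B.br a b) = β (ι a) (ι b) := by
  have key : ∀ a, ι (B.br a (pe K lam)) = β (ι a) (ι (pe K lam)) →
      ι (B.br a (ph K lam)) = β (ι a) (ι (ph K lam)) →
      ι (B.br a (pf K lam)) = β (ι a) (ι (pf K lam)) → ∀ b, ι (B.br a b) = β (ι a) (ι b) := by
    intro a h1 h2 h3 b
    refine PQ.derivation_ext ι (d := ι.toLinearMap ∘ₗ (B.der a).toLinearMap)
      (d' := (β (ι a)).toLinearMap ∘ₗ ι.toLinearMap) ?_ ?_ h1 h2 h3 b
    · intro x y
      show ι (B.br a (x * y)) = ι x * ι (B.br a y) + ι y * ι (B.br a x)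
      rw [B.leibniz, map_add, map_mul, map_mul, mul_comm (ι y)]
    · intro x y
      show β (ι a) (ι (x * y)) = ι x * β (ι a) (ι y) + ι y * β (ι a) (ι x)
      rw [map_mul, Derivation.leibniz, smul_eq_mul, smul_eq_mul]
  have he := key (pe K lam) (by rw [B.alternate, hβ0, map_zero])
    (by rw [br_pe_ph, hβ, ← hhe, map_mul, map_neg, map_ofNat]; ring)
    (by rw [B.br_ef, hef])
  have hh := key (ph K lam) (by rw [B.br_he, ← hhe, map_mul, map_ofNat])
    (by rw [B.alternate, hβ0, map_zero])
    (by rw [B.br_hf, ← hhf, map_mul, map_neg, map_ofNat])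
  have hf := key (pf K lam) (by rw [br_pf_pe, hβ, ← hef, map_neg])
    (by rw [br_pf_ph, hβ, ← hhf, map_mul, map_ofNat]; ring)
    (by rw [B.alternate, hβ0, map_zero])
  exact key a (by rw [B.antisymm, map_neg, he, hβ]; simp) (by rw [B.antisymm, map_neg, hh, hβ]; simp)
    (by rw [B.antisymm, map_neg, hf, hβ]; simp) b

end PoissonBr

theorem PAut.map_br {B : PoissonBr K lam} (φ : ↥(PAut B)) (a b : PQ K lam) :
    φ.val (B.br a b) = B.br (φ.val a) (φ.val b) := φ.2 a b

theorem PAut.mul_apply {B : PoissonBr K lam} (φ ψ : ↥(PAut B)) (a : PQ K lam) :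
    (φ * ψ).val a = φ.val (ψ.val a) := rfl

theorem PAut.one_apply {B : PoissonBr K lam} (a : PQ K lam) : (1 : ↥(PAut B)).val a = a := rfl

theorem PAut.apply_inv_apply {B : PoissonBr K lam} (φ : ↥(PAut B)) (a : PQ K lam) :
    φ.val ((φ⁻¹).val a) = a := φ.val.apply_symm_apply a

theorem PAut.ext {B : PoissonBr K lam} {φ ψ : ↥(PAut B)} (he : φ.val (pe K lam) = ψ.val (pe K lam))
    (hh : φ.val (ph K lam) = ψ.val (ph K lam)) (hf : φ.val (pf K lam) = ψ.val (pf K lam)) :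
    φ = ψ := by
  apply Subtype.ext
  have := PQ.algHom_ext (ι := φ.val.toAlgHom) (κ := ψ.val.toAlgHom) he hh hf
  ext F
  exact DFunLike.congr_fun this F

/-- The algebra endomorphism underlying `τ`. -/
def PQ.tauHom : PQ K lam →ₐ[K] PQ K lam :=
  PQ.lift (pf K lam) (-ph K lam) (pe K lam) (by linear_combination PQ.rel (K := K) (lam := lam))

theorem PQ.tauHom_pe : PQ.tauHom (pe K lam) = pf K lam := PQ.lift_pe _
theorem PQ.tauHom_ph : PQ.tauHom (ph K lam) = -ph K lam := PQ.lift_ph _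
theorem PQ.tauHom_pf : PQ.tauHom (pf K lam) = pe K lam := PQ.lift_pf _

theorem PQ.tauHom_comp : (PQ.tauHom (K := K) (lam := lam)).comp PQ.tauHom = AlgHom.id K _ := by
  apply PQ.algHom_ext <;> simp [PQ.tauHom_pe, PQ.tauHom_ph, PQ.tauHom_pf]

/-- The automorphism `τ`. -/
def tau (B : PoissonBr K lam) : ↥(PAut B) :=
  ⟨AlgEquiv.ofAlgHom PQ.tauHom PQ.tauHom PQ.tauHom_comp PQ.tauHom_comp, by
    refine B.map_br PQ.tauHom (fun x => B.der x) (fun x y => B.antisymm x y) B.alternate ?_ ?_ ?_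
    · simp only [PoissonBr.der_apply, PQ.tauHom_pe, PQ.tauHom_ph, PQ.tauHom_pf, B.br_pf_pe]
    · simp only [PoissonBr.der_apply, PQ.tauHom_pe, PQ.tauHom_ph]
      rw [B.antisymm, ← B.der_apply, map_neg, B.der_apply, B.br_pf_ph]; ring
    · simp only [PoissonBr.der_apply, PQ.tauHom_ph, PQ.tauHom_pf]
      rw [B.antisymm, ← B.der_apply, map_neg, B.der_apply, B.br_pe_ph]; ring⟩

theorem tau_isTau (B : PoissonBr K lam) : IsTau B (tau B) :=
  ⟨PQ.tauHom_pe, PQ.tauHom_ph, PQ.tauHom_pf⟩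

namespace Lau

open AddMonoidAlgebra

theorem algebraMap_eq_single (c : K) : algebraMap K (Lau K) c = single 0 (C c) := by
  rfl

/-- The embedding of `P_λ` into Laurent polynomials with `h ↦ X T^r` and `f ↦ T^α`. -/
def emb (α r : ℤ) : PQ K lam →ₐ[K] Lau K :=
  PQ.lift (single (-α) (C (lam / 4)) - single (2 * r - α) (C (1 / 4) * X ^ 2)) (single r X)
    (single α 1) (by
      have h4 : (4 : Lau K) = single 0 (C 4) := by
        rw [← algebraMap_eq_single, map_ofNat]
      have e1 : (C 4 : K[X]) * C (lam / 4) = C lam := by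
        rw [← C_mul]; congr 1; field_simp
      have e2 : (C 4 : K[X]) * (C (1 / 4) * X ^ 2) = X ^ 2 := by
        rw [← mul_assoc, ← C_mul]; simp
      rw [h4, mul_sub, sub_mul, single_mul_single, single_mul_single, single_mul_single,
        single_mul_single, sq (single r X : Lau K), single_mul_single, algebraMap_eq_single, e1, e2, mul_one, mul_one,
        ← sq, show (0 : ℤ) + (2 * r - α) + α = r + r by ring,
        show (0 : ℤ) + -α + α = 0 by ring, sub_add_cancel])

theorem emb_pe (α r : ℤ) : emb α r (pe K lam) =
    single (-α) (C (lam / 4)) - single (2 * r - α) (C (1 / 4) * X ^ 2) := PQ.lift_pe _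
theorem emb_ph (α r : ℤ) : emb α r (ph K lam) = single r X := PQ.lift_ph _
theorem emb_pf (α r : ℤ) : emb α r (pf K lam) = single α 1 := PQ.lift_pf _

theorem emb_br (B : PoissonBr K lam) {α : ℤ} (hα : α ≠ 0) (r : ℤ) (a b : PQ K lam) :
    emb α r (B.br a b) = poisson α r (emb α r a) (emb α r b) := by
  have hα' : (α : K) ≠ 0 := by exact_mod_cast hα
  have h2 : (2 : Lau K) = single 0 (C 2) := by
    rw [← algebraMap_eq_single, map_ofNat]
  refine B.map_br (emb α r) (poisson α r) ?_ ?_ ?_ ?_ ?_ a b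
  · intro x y; rw [poisson_apply, poisson_apply]; ring
  · intro x; rw [poisson_apply]; ring
  · rw [emb_pe, emb_ph, emb_pf, poisson_apply]
    simp only [map_sub, dX_single, euler_single, derivative_one, derivative_C, single_zero,
      mul_zero, sub_zero, zero_sub]
    rw [← single_neg, single_mul_single, single_mul_single]
    congr 1
    · ring
    · have : (α : K[X]) = C (α : K) := by simp
      rw [derivative_C_mul, derivative_X_sq, mul_one, this]
      trans C (-2 / (α : K) * (1 / 4) * (-2) * α) * X
      · rw [show -2 / (α : K) * (1 / 4) * (-2) * α = 1 by field_simp; norm_num]; simp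
      · simp only [map_mul, map_neg, map_ofNat]; ring
  · rw [emb_pe, emb_ph, poisson_apply, h2]
    simp only [map_sub, dX_single, euler_single, derivative_X, derivative_C, single_zero,
      zero_sub, mul_sub, ← single_neg, single_mul_single, one_mul]
    rw [show -r + (r + -α) = 0 + -α by ring, show -r + (r + (2 * r - α)) = 0 + (2 * r - α) by ring,
      sub_sub, ← single_add]
    have : (α : K[X]) = C (α : K) := by simp
    congr 2
    · push_cast
      rw [this, ← C_mul, ← C_neg, ← C_mul, ← C_mul]
      congr 1; field_simp; 
    · push_cast
      rw [derivative_C_mul, derivative_X_sq, this]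
      trans C (-2 / (α : K) * (1 / 4) * (-α)) * X ^ 2
      · rw [← mul_assoc, ← C_mul]; congr 2; field_simp
      · simp only [map_mul, map_neg, map_ofNat]; ring
  · rw [emb_pf, emb_ph, poisson_apply, show (-2 : Lau K) = single 0 (C (-2)) by
      rw [← algebraMap_eq_single, map_neg, map_ofNat]]
    simp only [dX_single, euler_single, derivative_X, derivative_one, single_zero, mul_zero,
      sub_zero, single_mul_single, one_mul]
    have : (α : K[X]) = C (α : K) := by simp
    congr 1
    · ring
    · rw [this, mul_one, mul_one, ← C_mul]; congr 1; field_simp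

end Lau

end

section

open Polynomial

namespace Lau

open AddMonoidAlgebra

theorem coeff_mul_single' (A : Lau K) (m w : ℤ) (p : K[X]) :
    (A * single m p).coeff w = A.coeff (w - m) * p := by
  rw [AddMonoidAlgebra.coeff_mul_single_apply, sub_eq_add_neg]

theorem coeff_emb_algebraMap (α r : ℤ) (c : K) (w : ℤ) :
    (emb α r (algebraMap K (PQ K lam) c)).coeff w = if 0 = w then C c else 0 := by
  rw [AlgHom.commutes, algebraMap_eq_single, coeff_single_eq]

theorem coeff_emb_mul_pe (α r : ℤ) (F : PQ K lam) (w : ℤ) :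
    (emb α r (F * pe K lam)).coeff w = C (lam / 4) * (emb α r F).coeff (w + α) -
      C (1 / 4) * ((emb α r F).coeff (w - 2 * r + α) * X ^ 2) := by
  rw [map_mul, emb_pe, mul_sub, AddMonoidAlgebra.coeff_sub, Finsupp.sub_apply, coeff_mul_single',
    coeff_mul_single', sub_neg_eq_add, show w - (2 * r - α) = w - 2 * r + α by ring]
  ring

theorem coeff_emb_mul_ph (α r : ℤ) (F : PQ K lam) (w : ℤ) :
    (emb α r (F * ph K lam)).coeff w = (emb α r F).coeff (w - r) * X := by
  rw [map_mul, emb_ph, coeff_mul_single']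

theorem coeff_emb_mul_pf (α r : ℤ) (F : PQ K lam) (w : ℤ) :
    (emb α r (F * pf K lam)).coeff w = (emb α r F).coeff (w - α) := by
  rw [map_mul, emb_pf, coeff_mul_single', mul_one]

theorem coeff_emb_add (α r : ℤ) (F G : PQ K lam) (w : ℤ) :
    (emb α r (F + G)).coeff w = (emb α r F).coeff w + (emb α r G).coeff w := by
  rw [map_add, AddMonoidAlgebra.coeff_add, Finsupp.add_apply]

end Lau

/-- The polynomial `(λ - X²)/4`, the value of `ef` in terms of `h`. -/
def disc (lam : K) : K[X] := C (lam / 4) - C (1 / 4) * X ^ 2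

theorem natDegree_disc : (disc lam).natDegree = 2 := by
  rw [disc, natDegree_sub_eq_right_of_natDegree_lt] <;>
  · rw [natDegree_C_mul_X_pow _ _ (by norm_num)]
    try simp

theorem disc_ne_zero : disc lam ≠ 0 := by
  intro h
  have := natDegree_disc (lam := lam)
  simp [h] at this

theorem disc_comp_neg_X : (disc lam).comp (-X) = disc lam := by
  simp [disc]

open Lau

/-- The coefficients of an element of `P_λ` in its expansion in `f` and `h`. -/
def cf (F : PQ K lam) (b : ℤ) : K[X] := (emb 1 0 F).coeff b

theorem cf_algebraMap (c : K) (b : ℤ) :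
    cf (algebraMap K (PQ K lam) c) b = if 0 = b then C c else 0 := coeff_emb_algebraMap 1 0 c b

theorem cf_add (F G : PQ K lam) (b : ℤ) : cf (F + G) b = cf F b + cf G b := coeff_emb_add 1 0 F G b

theorem cf_neg (F : PQ K lam) (b : ℤ) : cf (-F) b = -cf F b := by
  rw [cf, map_neg, AddMonoidAlgebra.coeff_neg, Finsupp.neg_apply, cf]

theorem cf_sub (F G : PQ K lam) (b : ℤ) : cf (F - G) b = cf F b - cf G b := by
  rw [sub_eq_add_neg, cf_add, cf_neg, sub_eq_add_neg]

theorem cf_smul (c : K) (F : PQ K lam) (b : ℤ) : cf (c • F) b = C c * cf F b := by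
  rw [cf, map_smul, AddMonoidAlgebra.coeff_smul, Finsupp.smul_apply, smul_eq_C_mul, cf]

theorem cf_mul_pe (F : PQ K lam) (b : ℤ) : cf (F * pe K lam) b = cf F (b + 1) * disc lam := by
  rw [cf, coeff_emb_mul_pe, disc, mul_zero, sub_zero, cf]
  ring

theorem cf_mul_ph (F : PQ K lam) (b : ℤ) : cf (F * ph K lam) b = cf F b * X := by
  rw [cf, coeff_emb_mul_ph, sub_zero, cf]

theorem cf_mul_pf (F : PQ K lam) (b : ℤ) : cf (F * pf K lam) b = cf F (b - 1) :=
  coeff_emb_mul_pf 1 0 F b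

theorem emb_one_zero_pe : emb 1 0 (pe K lam) = AddMonoidAlgebra.single (-1) (disc lam) := by
  rw [emb_pe, disc, mul_zero, zero_sub, ← AddMonoidAlgebra.single_sub]

/-- The coefficients of the weighted embedding are those of the standard one. -/
theorem coeff_coeff_emb {α : ℤ} (hα : α ≠ 0) (r : ℤ) (F : PQ K lam) : ∀ (b : ℤ) (a : ℕ),
    ((emb α r F).coeff (α * b + r * a)).coeff a = (cf F b).coeff a := by
  induction F using PQ.induction with
  | hC c =>
    intro b a
    rw [coeff_emb_algebraMap, cf_algebraMap]
    rcases a with _ | a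
    · rcases eq_or_ne b 0 with rfl | hb
      · simp
      · rw [if_neg, if_neg hb.symm]
        simpa using ⟨hα, hb⟩
    · split_ifs <;> simp
  | hadd F G hF hG =>
    intro b a
    rw [coeff_emb_add, cf_add, coeff_add, coeff_add, hF, hG]
  | he F hF =>
    intro b a
    have h1 := hF (b + 1) a
    rw [show α * (b + 1) + r * a = α * b + r * a + α by ring] at h1
    have h2 : ((emb α r F).coeff (α * b + r * a - 2 * r + α) * X ^ 2).coeff a =
        (cf F (b + 1) * X ^ 2).coeff a := by
      rcases a with _ | _ | a
      · simp [mul_coeff_zero]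
      · simp [coeff_mul_X_pow']
      · rw [coeff_mul_X_pow, coeff_mul_X_pow, ← hF,
          show α * b + r * ((a + 1 + 1 : ℕ) : ℤ) - 2 * r + α = α * (b + 1) + r * a by
            push_cast; ring]
    rw [coeff_emb_mul_pe, cf_mul_pe, coeff_sub, coeff_C_mul, coeff_C_mul, h1, h2,
      show cf F (b + 1) * disc lam = C (lam / 4) * cf F (b + 1) -
        C (1 / 4) * (cf F (b + 1) * X ^ 2) by rw [disc]; ring, coeff_sub, coeff_C_mul, coeff_C_mul]
  | hh F hF =>
    intro b a
    rw [coeff_emb_mul_ph, cf_mul_ph]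
    rcases a with _ | a
    · simp
    · rw [coeff_mul_X, coeff_mul_X, ← hF]
      congr 2
      push_cast; ring
  | hf F hF =>
    intro b a
    rw [coeff_emb_mul_pf, cf_mul_pf, ← hF]
    congr 2
    ring

theorem exists_of_coeff_coeff_emb_ne_zero (α r : ℤ) (F : PQ K lam) : ∀ {w : ℤ} {a : ℕ},
    ((emb α r F).coeff w).coeff a ≠ 0 → ∃ b : ℤ, α * b + r * a = w := by
  induction F using PQ.induction with
  | hC c =>
    intro w a h
    rw [coeff_emb_algebraMap] at h
    split_ifs at h with hw
    · rw [coeff_C] at h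
      split_ifs at h with ha
      · exact ⟨0, by subst hw ha; simp⟩
      · exact absurd rfl h
    · simp at h
  | hadd F G hF hG =>
    intro w a h
    rw [coeff_emb_add, coeff_add] at h
    by_cases h1 : ((emb α r F).coeff w).coeff a = 0
    · rw [h1, zero_add] at h
      exact hG h
    · exact hF h1
  | he F hF =>
    intro w a h
    rw [coeff_emb_mul_pe, coeff_sub, coeff_C_mul, coeff_C_mul] at h
    by_cases h1 : ((emb α r F).coeff (w + α)).coeff a = 0
    · rw [h1, mul_zero, zero_sub, neg_ne_zero] at h
      have h2 := right_ne_zero_of_mul h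
      rcases a with _ | _ | a
      · simp at h2
      · simp [coeff_mul_X_pow'] at h2
      · rw [coeff_mul_X_pow] at h2
        obtain ⟨b, hb⟩ := hF h2
        exact ⟨b - 1, by push_cast; linear_combination hb⟩
    · obtain ⟨b, hb⟩ := hF h1
      exact ⟨b - 1, by linear_combination hb⟩
  | hh F hF =>
    intro w a h
    rw [coeff_emb_mul_ph] at h
    rcases a with _ | a
    · simp at h
    · rw [coeff_mul_X] at h
      obtain ⟨b, hb⟩ := hF h
      exact ⟨b, by push_cast; linear_combination hb⟩
  | hf F hF =>
    intro w a h
    rw [coeff_emb_mul_pf] at h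
    obtain ⟨b, hb⟩ := hF h
    exact ⟨b + 1, by linear_combination hb⟩

theorem disc_pow_dvd_cf (F : PQ K lam) : ∀ i : ℕ, disc lam ^ i ∣ cf F (-i) := by
  induction F using PQ.induction with
  | hC c =>
    rintro (_ | i)
    · simp
    · rw [cf_algebraMap, if_neg (by push_cast; omega)]
      exact dvd_zero _
  | hadd F G hF hG => exact fun i => by rw [cf_add]; exact dvd_add (hF i) (hG i)
  | he F hF =>
    rintro (_ | i)
    · simp
    · rw [cf_mul_pe, pow_succ, show -((i + 1 : ℕ) : ℤ) + 1 = -i by push_cast; ring]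
      exact mul_dvd_mul_right (hF i) _
  | hh F hF => exact fun i => by rw [cf_mul_ph]; exact (hF i).mul_right _
  | hf F hF =>
    intro i
    rw [cf_mul_pf, show -(i : ℤ) - 1 = -((i + 1 : ℕ) : ℤ) by push_cast; ring]
    exact (pow_dvd_pow _ (Nat.le_succ i)).trans (hF (i + 1))

/-- The effect of `τ` on the coefficients. -/
theorem cf_tauHom (F : PQ K lam) : ∀ i : ℕ,
    cf (PQ.tauHom F) (-i) = (cf F i).comp (-X) * disc lam ^ i ∧
      cf F (-i) = (cf (PQ.tauHom F) i).comp (-X) * disc lam ^ i := by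
  have hX : (-X : K[X]).comp (-X) = X := by simp
  induction F using PQ.induction with
  | hC c =>
    rintro (_ | i)
    · simp [cf_algebraMap]
    · rw [AlgHom.commutes, cf_algebraMap, cf_algebraMap, if_neg (by push_cast; omega),
        if_neg (by push_cast; omega)]
      simp
  | hadd F G hF hG =>
    intro i
    rw [map_add, cf_add, cf_add, cf_add, cf_add, (hF i).1, (hF i).2, (hG i).1, (hG i).2]
    simp only [add_comp]
    constructor <;> ring
  | he F hF =>
    intro i
    rw [map_mul, PQ.tauHom_pe, cf_mul_pf, cf_mul_pf, cf_mul_pe, cf_mul_pe]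
    refine ⟨?_, ?_⟩
    · have h := (hF (i + 1)).1
      rw [show -(i : ℤ) - 1 = -((i + 1 : ℕ) : ℤ) by push_cast; ring, h, mul_comp, disc_comp_neg_X]
      push_cast; ring
    · rcases i with _ | i
      · have h := (hF 1).1
        simp only [Nat.cast_zero, neg_zero, zero_add, zero_sub, pow_zero, mul_one]
        rw [show (-1 : ℤ) = -((1 : ℕ) : ℤ) by simp, h]
        simp [comp_assoc, disc_comp_neg_X]
      · rw [show -((i + 1 : ℕ) : ℤ) + 1 = -i by push_cast; ring, (hF i).2,
          show ((i + 1 : ℕ) : ℤ) - 1 = i by push_cast; ring]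
        ring
  | hh F hF =>
    intro i
    rw [map_mul, PQ.tauHom_ph,
      show PQ.tauHom F * -ph K lam = -(PQ.tauHom F * ph K lam) by ring, cf_neg, cf_neg, cf_mul_ph, cf_mul_ph, cf_mul_ph, cf_mul_ph,
      (hF i).1]
    simp only [mul_comp, neg_comp, X_comp]
    refine ⟨by ring, ?_⟩
    rw [(hF i).2]
    ring
  | hf F hF =>
    intro i
    rw [map_mul, PQ.tauHom_pf, cf_mul_pf, cf_mul_pf, cf_mul_pe, cf_mul_pe]
    refine ⟨?_, ?_⟩
    · rcases i with _ | i
      · have h := (hF 1).2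
        simp only [Nat.cast_zero, neg_zero, zero_add, zero_sub, pow_zero, mul_one]
        rw [show (-1 : ℤ) = -((1 : ℕ) : ℤ) by simp, h]
        simp [comp_assoc, disc_comp_neg_X]
      · rw [show -((i + 1 : ℕ) : ℤ) + 1 = -i by push_cast; ring, (hF i).1,
          show ((i + 1 : ℕ) : ℤ) - 1 = i by push_cast; ring]
        ring
    · have h := (hF (i + 1)).2
      rw [show -(i : ℤ) - 1 = -((i + 1 : ℕ) : ℤ) by push_cast; ring, h, mul_comp, disc_comp_neg_X]
      push_cast; ring

/-- Evaluation of a polynomial in `h` and `x` at `x ∈ P_λ`. -/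
def ev (x : PQ K lam) : K[X][X] →+* PQ K lam :=
  eval₂RingHom (aeval (ph K lam)).toRingHom x

theorem ev_C (x : PQ K lam) (p : K[X]) : ev x (C p) = aeval (ph K lam) p := by simp [ev]

theorem ev_X (x : PQ K lam) : ev x X = x := by simp [ev]

theorem pe_mul_pf : pe K lam * pf K lam = aeval (ph K lam) (disc lam) := by
  have h := PQ.rel (K := K) (lam := lam)
  have h4 : (4 : PQ K lam) * algebraMap K _ (1 / 4) = 1 := by
    rw [← map_ofNat (algebraMap K (PQ K lam)) 4, ← map_mul]
    norm_num
  have e1 : aeval (ph K lam) (disc lam) =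
      algebraMap K _ lam * algebraMap K _ (1 / 4) - algebraMap K _ (1 / 4) * ph K lam ^ 2 := by
    rw [← map_mul, disc, mul_one_div]
    simp only [map_sub, map_mul, aeval_C, map_pow, aeval_X]
  rw [e1]
  linear_combination algebraMap K (PQ K lam) (1 / 4) * h - pe K lam * pf K lam * h4

theorem PQ.exists_normal_form (F : PQ K lam) :
    ∃ p q : K[X][X], F = ev (pe K lam) p + pf K lam * ev (pf K lam) q := by
  induction F using PQ.induction with
  | hC c => exact ⟨C (C c), 0, by simp [ev_C]⟩
  | hadd F G hF hG =>
    obtain ⟨p, q, rfl⟩ := hF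
    obtain ⟨p', q', rfl⟩ := hG
    exact ⟨p + p', q + q', by simp only [map_add]; ring⟩
  | he F hF =>
    obtain ⟨p, q, rfl⟩ := hF
    refine ⟨p * X + C (disc lam * q.coeff 0), C (disc lam) * q.divX, ?_⟩
    nth_rewrite 1 [← divX_mul_X_add q]
    simp only [map_add, map_mul, ev_X, ev_C]
    linear_combination (ev (pf K lam) q.divX * pf K lam + aeval (ph K lam) (q.coeff 0)) *
      pe_mul_pf (K := K) (lam := lam)
  | hh F hF =>
    obtain ⟨p, q, rfl⟩ := hF
    exact ⟨p * C X, q * C X, by simp only [map_mul, ev_C, aeval_X]; ring⟩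
  | hf F hF =>
    obtain ⟨p, q, rfl⟩ := hF
    refine ⟨C (disc lam) * p.divX, q * X + C (p.coeff 0), ?_⟩
    nth_rewrite 1 [← divX_mul_X_add p]
    simp only [map_add, map_mul, ev_X, ev_C]
    linear_combination ev (pe K lam) p.divX * pe_mul_pf (K := K) (lam := lam)

theorem cf_aeval_ph (p : K[X]) (b : ℤ) :
    cf (aeval (ph K lam) p) b = if 0 = b then p else 0 := by
  have : emb 1 0 (aeval (ph K lam) p) = AddMonoidAlgebra.single 0 p := by
    induction p using Polynomial.induction_on with
    | C c => rw [aeval_C, AlgHom.commutes, algebraMap_eq_single]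
    | add p q hp hq => rw [map_add, map_add, hp, hq, AddMonoidAlgebra.single_add]
    | monomial n c h =>
      rw [pow_succ X n, ← mul_assoc (C c), map_mul, map_mul, h, aeval_X, emb_ph,
        AddMonoidAlgebra.single_mul_single, add_zero]
  rw [cf, this, coeff_single_eq]

theorem cf_ev_pe (p : K[X][X]) : ∀ b : ℤ,
    cf (ev (pe K lam) p) b = if 0 < b then 0 else p.coeff (-b).toNat * disc lam ^ (-b).toNat := by
  induction p using Polynomial.induction_on with
  | C c =>
    intro b
    rw [ev_C, cf_aeval_ph]
    split_ifs with h1 h2 h2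
    · omega
    · simp [← h1]
    · rfl
    · rw [coeff_C, if_neg (by omega), zero_mul]
  | add p q hp hq =>
    intro b
    rw [map_add, cf_add, hp, hq]
    split_ifs
    · simp
    · rw [coeff_add, add_mul]
  | monomial n c h =>
    intro b
    rw [pow_succ X n, ← mul_assoc (C c), map_mul, ev_X, cf_mul_pe, h]
    split_ifs with h1 h2 h2
    · simp
    · obtain rfl : b = 0 := by omega
      simp
    · omega
    · obtain ⟨i, rfl⟩ : ∃ i : ℕ, b = -((i + 1 : ℕ) : ℤ) := ⟨(-b - 1).toNat, by omega⟩
      rw [show (-(-((i + 1 : ℕ) : ℤ) + 1)).toNat = i by omega,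
        show (- -((i + 1 : ℕ) : ℤ)).toNat = i + 1 by omega, coeff_mul_X, pow_succ (disc lam),
          mul_assoc]

theorem cf_ev_pf (p : K[X][X]) : ∀ b : ℤ,
    cf (ev (pf K lam) p) b = if b < 0 then 0 else p.coeff b.toNat := by
  induction p using Polynomial.induction_on with
  | C c =>
    intro b
    rw [ev_C, cf_aeval_ph]
    split_ifs with h1 h2 h2
    · omega
    · simp [← h1]
    · rfl
    · rw [coeff_C, if_neg (by omega)]
  | add p q hp hq =>
    intro b
    rw [map_add, cf_add, hp, hq]
    split_ifs
    · simp
    · rw [coeff_add]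
  | monomial n c h =>
    intro b
    rw [pow_succ X n, ← mul_assoc (C c), map_mul, ev_X, cf_mul_pf, h]
    split_ifs with h1 h2 h2
    · simp
    · obtain rfl : b = 0 := by omega
      simp
    · omega
    · obtain ⟨i, rfl⟩ : ∃ i : ℕ, b = ((i + 1 : ℕ) : ℤ) := ⟨(b - 1).toNat, by omega⟩
      rw [show (((i + 1 : ℕ) : ℤ) - 1).toNat = i by omega,
        show (((i + 1 : ℕ) : ℤ)).toNat = i + 1 by omega, coeff_mul_X]

theorem PQ.eq_zero_of_cf {F : PQ K lam} (hF : ∀ b, cf F b = 0) : F = 0 := by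
  obtain ⟨p, q, rfl⟩ := PQ.exists_normal_form F
  have hp : p = 0 := by
    ext1 i
    have h := hF (-i)
    rw [cf_add, mul_comm (pf K lam), cf_mul_pf, cf_ev_pf, if_pos (by omega), cf_ev_pe, if_neg (by omega),
      add_zero, mul_eq_zero, neg_neg, Int.toNat_natCast] at h
    exact h.resolve_right (pow_ne_zero _ disc_ne_zero)
  have hq : q = 0 := by
    ext1 i
    have h := hF (i + 1)
    rwa [cf_add, mul_comm (pf K lam), cf_mul_pf, cf_ev_pf, if_neg (by omega), cf_ev_pe, if_pos (by omega),
      zero_add, add_sub_cancel_right, Int.toNat_natCast] at h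
  simp [hp, hq]

theorem PQ.ext_cf {F G : PQ K lam} (h : ∀ b, cf F b = cf G b) : F = G :=
  sub_eq_zero.1 (PQ.eq_zero_of_cf fun b => by rw [cf_sub, h, sub_self])

theorem cf_aeval_pf (s : K[X]) (b : ℤ) :
    cf (aeval (pf K lam) s) b = if b < 0 then 0 else C (s.coeff b.toNat) := by
  have : aeval (pf K lam) s = ev (pf K lam) (s.map C) := by
    rw [ev, coe_eval₂RingHom, eval₂_map, aeval_def]
    congr 1
    ext x
    simp
  rw [this, cf_ev_pf, coeff_map]

theorem exists_cf_eq_zero (F : PQ K lam) : ∃ N : ℕ, ∀ b : ℤ, N < b → cf F b = 0 := by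
  by_cases h : emb 1 0 F = 0
  · exact ⟨0, fun b _ => by rw [cf, h]; rfl⟩
  · obtain ⟨W, hW, -⟩ := Lau.exists_topLE h
    exact ⟨W.toNat, fun b hb => hW b (by omega)⟩

/-- An element with constant coefficients and no negative ones is a polynomial in `f`. -/
theorem exists_aeval_pf {F : PQ K lam} (hneg : ∀ b < 0, cf F b = 0)
    (hconst : ∀ b, ∃ c, cf F b = C c) : ∃ s : K[X], F = aeval (pf K lam) s := by
  obtain ⟨N, hN⟩ := exists_cf_eq_zero F
  refine ⟨∑ i ∈ Finset.range (N + 1), monomial i ((cf F i).coeff 0), PQ.ext_cf fun b => ?_⟩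
  rw [cf_aeval_pf]
  split_ifs with hb
  · exact hneg b hb
  · lift b to ℕ using not_lt.1 hb
    rw [finsetSum_coeff, Int.toNat_natCast]
    simp only [coeff_monomial]
    rw [Finset.sum_ite_eq']
    split_ifs with h
    · obtain ⟨c, hc⟩ := hconst b
      simp [hc]
    · rw [hN b (by simp at h; omega), C_0]

theorem emb_injective {α : ℤ} (hα : α ≠ 0) (r : ℤ) :
    Function.Injective (emb α r : PQ K lam → Lau K) := by
  rw [injective_iff_map_eq_zero]
  intro F hF
  refine PQ.eq_zero_of_cf fun b => ?_
  ext a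
  rw [← coeff_coeff_emb hα r, hF]
  simp

end

section

open Polynomial Lau

theorem derivation_iterate_mul {S : Type*} [CommRing S] [Algebra K S] (D : Derivation K S S) (n : ℕ) :
    ∀ (i j : ℕ) (x y : S), i + j = n → D^[i] x = 0 → D^[j] y = 0 → D^[n] (x * y) = 0 := by
  induction n with
  | zero =>
    rintro i j x y hij hx -
    obtain rfl : i = 0 := by omega
    obtain rfl : x = 0 := hx
    simp
  | succ n ih =>
    rintro i j x y hij hx hy
    have h0 : ∀ k, D^[k] 0 = 0 := fun k => iterate_map_zero D k
    rcases i with _ | i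
    · obtain rfl : x = 0 := hx
      rw [zero_mul, h0]
    rcases j with _ | j
    · obtain rfl : y = 0 := hy
      rw [mul_zero, h0]
    rw [Function.iterate_succ_apply, Derivation.leibniz, iterate_map_add, smul_eq_mul, smul_eq_mul,
      ih (i + 1) j x (D y) (by omega) hx hy, ih (j + 1) i y (D x) (by omega) hy hx, add_zero]

theorem derivation_iterate_eq_zero_of_le {S : Type*} [CommRing S] [Algebra K S]
    (D : Derivation K S S) {x : S} {k l : ℕ} (h : k ≤ l) (hx : D^[k] x = 0) : D^[l] x = 0 := by
  obtain ⟨m, rfl⟩ := Nat.exists_eq_add_of_le' h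
  rw [Function.iterate_add_apply, hx, iterate_map_zero]

theorem PQ.smul_eq (c : K) (x : PQ K lam) : c • x = algebraMap K (PQ K lam) c * x :=
  Algebra.smul_def c x

theorem cf_zero (b : ℤ) : cf (0 : PQ K lam) b = 0 := by
  rw [cf, map_zero]
  rfl

theorem cf_pe (b : ℤ) : cf (pe K lam) b = if -1 = b then disc lam else 0 := by
  rw [cf, emb_one_zero_pe, coeff_single_eq]

theorem cf_ph (b : ℤ) : cf (ph K lam) b = if 0 = b then X else 0 := by
  rw [cf, emb_ph, coeff_single_eq]

theorem cf_pf (b : ℤ) : cf (pf K lam) b = if 1 = b then 1 else 0 := by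
  rw [cf, emb_pf, coeff_single_eq]

section br

variable (B : PoissonBr K lam)

theorem exists_iterate_br_pf (x : PQ K lam) : ∃ k, (B.br (pf K lam))^[k] x = 0 := by
  have hz : B.br (pf K lam) 0 = 0 := map_zero (B.der (pf K lam))
  have mul : ∀ x y, (∃ k, (B.br (pf K lam))^[k] x = 0) → (∃ k, (B.br (pf K lam))^[k] y = 0) →
      ∃ k, (B.br (pf K lam))^[k] (x * y) = 0 := by
    rintro x y ⟨i, hi⟩ ⟨j, hj⟩
    exact ⟨i + j, derivation_iterate_mul (B.der (pf K lam)) _ i j x y rfl hi hj⟩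
  have h2 : (B.br (pf K lam)) (2 * pf K lam) = 0 := by
    have h : B.der (pf K lam) (2 * pf K lam) = 0 := by
      rw [two_mul, map_add, B.der_apply, B.alternate, add_zero]
    exact h
  induction x using PQ.induction with
  | hC c => exact ⟨1, Derivation.map_algebraMap (B.der (pf K lam)) c⟩
  | hadd F G hF hG =>
    obtain ⟨i, hi⟩ := hF
    obtain ⟨j, hj⟩ := hG
    refine ⟨i + j, ?_⟩
    have h1 := derivation_iterate_eq_zero_of_le (B.der (pf K lam)) (Nat.le_add_right i j) hi
    have h2 := derivation_iterate_eq_zero_of_le (B.der (pf K lam)) (Nat.le_add_left j i) hj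
    have h3 := iterate_map_add (B.der (pf K lam)) (i + j) F G
    rw [h1, h2, add_zero] at h3
    exact h3
  | he F hF =>
    refine mul _ _ hF ⟨3, ?_⟩
    have h3 : B.der (pf K lam) (-ph K lam) = -(2 * pf K lam) := by
      rw [map_neg, B.der_apply, B.br_pf_ph]
    have h4 : B.der (pf K lam) (-(2 * pf K lam)) = 0 := by
      rw [map_neg, B.der_apply, h2, neg_zero]
    rw [B.der_apply] at h3 h4
    rw [Function.iterate_succ_apply, Function.iterate_succ_apply, Function.iterate_succ_apply,
      B.br_pf_pe, h3, h4]
    rfl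
  | hh F hF =>
    refine mul _ _ hF ⟨2, ?_⟩
    rw [Function.iterate_succ_apply, Function.iterate_succ_apply, B.br_pf_ph, h2]
    rfl
  | hf F hF => exact mul _ _ hF ⟨1, B.alternate _⟩

theorem exists_iterate_br_map_pf {B : PoissonBr K lam} (φ : ↥(PAut B)) (x : PQ K lam) :
    ∃ k, (B.br (φ.val (pf K lam)))^[k] x = 0 := by
  obtain ⟨k, hk⟩ := exists_iterate_br_pf B ((φ⁻¹).val x)
  refine ⟨k, ?_⟩
  have h : Function.Semiconj φ.val (B.br (pf K lam)) (B.br (φ.val (pf K lam))) :=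
    fun y => PAut.map_br φ _ y
  have h1 := (h.iterate_right k) ((φ⁻¹).val x)
  rwa [hk, map_zero, PAut.apply_inv_apply, eq_comm] at h1

theorem exists_iterate_poisson {B : PoissonBr K lam} (φ : ↥(PAut B)) {α : ℤ} (hα : α ≠ 0) (r : ℤ)
    (x : PQ K lam) :
    ∃ k, (poisson α r (emb α r (φ.val (pf K lam))))^[k] (emb α r x) = 0 := by
  obtain ⟨k, hk⟩ := exists_iterate_br_map_pf φ x
  refine ⟨k, ?_⟩
  have h : Function.Semiconj (emb α r) (B.br (φ.val (pf K lam)))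
      (poisson α r (emb α r (φ.val (pf K lam)))) := fun y => emb_br B hα r _ y
  have h1 := (h.iterate_right k) x
  rwa [hk, map_zero, eq_comm] at h1

theorem cf_br_pf (x : PQ K lam) (b : ℤ) :
    cf (B.br (pf K lam) x) b = C 2 * derivative (cf x (b - 1)) := by
  rw [cf, emb_br B one_ne_zero, poisson_apply, emb_pf, dX_single, euler_single, derivative_one,
    AddMonoidAlgebra.single_zero, zero_mul, zero_sub,
    show AddMonoidAlgebra.single (-0 : ℤ) (C (-2 / ((1 : ℤ) : K))) *
      -(AddMonoidAlgebra.single (1 : ℤ) (((1 : ℤ) : K[X]) * 1) * dX (emb 1 0 x)) =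
      -(dX (emb 1 0 x) * (AddMonoidAlgebra.single (-0) (C (-2 / ((1 : ℤ) : K))) *
        AddMonoidAlgebra.single 1 (((1 : ℤ) : K[X]) * 1))) by ring,
    AddMonoidAlgebra.single_mul_single, AddMonoidAlgebra.coeff_neg, Finsupp.neg_apply,
    coeff_mul_single', coeff_dX, cf, neg_zero, zero_add]
  simp [mul_comm]

end br

theorem cf_eq_zero_of_natDegree_lt {F : PQ K lam} {b : ℤ}
    (h : ((cf F b).natDegree : ℤ) < -2 * b) : cf F b = 0 := by
  obtain ⟨i, rfl⟩ : ∃ i : ℕ, b = -i := ⟨(-b).toNat, by omega⟩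
  refine eq_zero_of_dvd_of_natDegree_lt (disc_pow_dvd_cf F i) ?_
  rw [natDegree_pow, natDegree_disc]
  omega

theorem exists_eq_C_of_derivative_eq_zero {p : K[X]} (h : derivative p = 0) : ∃ c, p = C c :=
  ⟨_, eq_C_of_natDegree_eq_zero (derivative_eq_zero.1 h)⟩

/-- The centralizer of `f` is `K[f]`. -/
theorem exists_aeval_pf_of_br (B : PoissonBr K lam) {x : PQ K lam} (hx : B.br (pf K lam) x = 0) :
    ∃ s : K[X], x = aeval (pf K lam) s := by
  have h : ∀ b, ∃ c, cf x b = C c := by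
    intro b
    apply exists_eq_C_of_derivative_eq_zero
    have h1 := cf_br_pf B x (b + 1)
    rw [hx, add_sub_cancel_right] at h1
    rw [cf_zero, eq_comm, mul_eq_zero] at h1
    exact h1.resolve_left (by simp)
  refine exists_aeval_pf (fun b hb => cf_eq_zero_of_natDegree_lt ?_) h
  obtain ⟨c, hc⟩ := h b
  rw [hc, natDegree_C]
  push_cast; omega

theorem br_pf_aeval (B : PoissonBr K lam) (s : K[X]) :
    B.br (pf K lam) (aeval (pf K lam) s) = 0 := by
  refine PQ.eq_zero_of_cf fun b => ?_
  rw [cf_br_pf, cf_aeval_pf]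
  split_ifs <;> simp

theorem aeval_pf_injective : Function.Injective (aeval (pf K lam) : K[X] → PQ K lam) := by
  intro s t h
  ext n
  have h1 := congrArg (fun F => cf F n) h
  simp only [cf_aeval_pf, Int.toNat_natCast] at h1
  rw [if_neg (by omega), if_neg (by omega)] at h1
  exact C_injective h1

theorem pf_mul_cancel {F G : PQ K lam} (h : F * pf K lam = G * pf K lam) : F = G := by
  refine PQ.ext_cf fun b => ?_
  have h1 := congrArg (fun F => cf F (b + 1)) h
  simpa [cf_mul_pf] using h1

/-- An automorphism stabilising `K[f]` multiplies `f` by a nonzero scalar and translates `h`. -/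
theorem exists_of_map_pf {B : PoissonBr K lam} (φ : ↥(PAut B)) {q : K[X]}
    (hq : φ.val (pf K lam) = aeval (pf K lam) q) :
    ∃ (c : K) (g : K[X]), c ≠ 0 ∧ φ.val (pf K lam) = c • pf K lam ∧
      φ.val (ph K lam) = ph K lam + 2 * (pf K lam * aeval (pf K lam) g) ∧
      c • φ.val (pe K lam) = pe K lam - aeval (pf K lam) g * ph K lam -
        pf K lam * aeval (pf K lam) g ^ 2 := by
  obtain ⟨s, hs⟩ : ∃ s : K[X], (φ⁻¹).val (pf K lam) = aeval (pf K lam) s := by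
    apply exists_aeval_pf_of_br B
    apply φ.val.injective
    rw [PAut.map_br, PAut.apply_inv_apply, hq, B.antisymm, br_pf_aeval, neg_zero, map_zero]
  have hsq : s.comp q = X := by
    apply aeval_pf_injective (lam := lam)
    have h1 := congrArg φ.val hs
    rw [PAut.apply_inv_apply] at h1
    rw [aeval_X, aeval_comp, ← hq]
    exact (aeval_algHom_apply φ.val.toAlgHom (pf K lam) s).trans h1.symm
  have hdeg : q.natDegree = 1 := by
    have h1 := congrArg natDegree hsq
    rw [natDegree_comp, natDegree_X] at h1
    exact Nat.eq_one_of_mul_eq_one_left h1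
  obtain ⟨c, hc, d, rfl⟩ : ∃ c : K, c ≠ 0 ∧ ∃ d : K, q = C c * X + C d := by
    obtain ⟨c, hc, d, h⟩ := natDegree_eq_one.1 hdeg
    exact ⟨c, hc, d, h.symm⟩
  have hq' : φ.val (pf K lam) = c • pf K lam + algebraMap K _ d := by
    rw [hq, PQ.smul_eq]; simp
  have hder : ∀ b, derivative (cf (φ.val (ph K lam)) b) =
      (if 0 = b then 1 else 0) + (if -1 = b then C (d / c) else 0) := by
    intro b
    have h1 : c • B.br (pf K lam) (φ.val (ph K lam)) = (2 : K) • φ.val (pf K lam) := by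
      have h2 := PAut.map_br φ (ph K lam) (pf K lam)
      rw [B.br_hf, map_mul, map_neg, map_ofNat] at h2
      have h3 : B.br (φ.val (ph K lam)) (φ.val (pf K lam)) =
          c • B.br (φ.val (ph K lam)) (pf K lam) := by
        rw [hq', ← B.der_apply, map_add, Derivation.map_algebraMap, add_zero, Derivation.map_smul,
          B.der_apply]
      rw [B.antisymm, smul_neg, ← h3, ← h2, PQ.smul_eq, map_ofNat]
      ring
    have h4 := congrArg (fun F => cf F (b + 1)) h1
    simp only [cf_smul, cf_br_pf, hq', cf_add, cf_pf, cf_algebraMap, add_sub_cancel_right] at h4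
    have hc' : (C c : K[X]) ≠ 0 := C_ne_zero.2 hc
    have h2' : (C 2 : K[X]) ≠ 0 := C_ne_zero.2 two_ne_zero
    apply mul_left_cancel₀ (mul_ne_zero hc' h2')
    rw [mul_assoc, h4]
    have e0 : (1 : ℤ) = b + 1 ↔ 0 = b := by omega
    have e1 : (0 : ℤ) = b + 1 ↔ -1 = b := by omega
    have e2 : (C d : K[X]) = C c * C (d / c) := by rw [← C_mul, mul_div_cancel₀ _ hc]
    simp only [e0, e1, e2]
    split_ifs <;> ring
  have hd : d = 0 := by
    have h1 := hder (-1)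
    rw [if_neg (by norm_num), if_pos rfl, zero_add] at h1
    have h2 : cf (φ.val (ph K lam)) (-1) = 0 := by
      apply cf_eq_zero_of_natDegree_lt
      obtain ⟨a, ha⟩ : ∃ a, cf (φ.val (ph K lam)) (-1) - C (d / c) * X = C a := by
        apply exists_eq_C_of_derivative_eq_zero
        rw [derivative_sub, h1, derivative_C_mul, derivative_X, mul_one, sub_self]
      rw [sub_eq_iff_eq_add'.1 ha]
      have h3 := natDegree_linear_le (a := d / c) (b := a)
      omega
    rw [h2, derivative_zero, eq_comm, C_eq_zero, div_eq_zero_iff] at h1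
    exact h1.resolve_right hc
  subst hd
  obtain ⟨s, hs⟩ : ∃ s : K[X], φ.val (ph K lam) - ph K lam = aeval (pf K lam) s := by
    apply exists_aeval_pf_of_br B
    refine PQ.eq_zero_of_cf fun b => ?_
    rw [cf_br_pf, cf_sub, derivative_sub, hder, cf_ph]
    split_ifs <;> simp
  rw [map_zero, add_zero] at hq'
  have hH : φ.val (ph K lam) = ph K lam + aeval (pf K lam) s := by rw [← hs]; ring
  have h4 : (c • φ.val (pe K lam) - pe K lam) * pf K lam * 4 =
      -(2 * aeval (pf K lam) s * ph K lam) - aeval (pf K lam) (s ^ 2) := by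
    have h1 := congrArg φ.val (PQ.rel (K := K) (lam := lam))
    rw [map_add, map_mul, map_mul, map_pow, map_ofNat, hq', hH, AlgEquiv.commutes,
      ← PQ.rel, PQ.smul_eq] at h1
    rw [PQ.smul_eq, map_pow]
    linear_combination h1
  have hs0 : s.coeff 0 = 0 := by
    have h5 : (4 : K) • ((c • φ.val (pe K lam) - pe K lam) * pf K lam) =
        (-2 : K) • (aeval (pf K lam) s * ph K lam) - aeval (pf K lam) (s ^ 2) := by
      rw [PQ.smul_eq 4, PQ.smul_eq (-2), map_neg, map_ofNat, map_ofNat]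
      linear_combination h4
    have h6 := congrArg (fun F => cf F 0) h5
    simp only [cf_smul, cf_mul_pf, cf_mul_ph, cf_sub (_ • (_ * _)), cf_aeval_pf, lt_irrefl,
      if_false, Int.toNat_zero, zero_sub] at h6
    have h7 : cf (c • φ.val (pe K lam) - pe K lam) (-1) = 0 := by
      apply cf_eq_zero_of_natDegree_lt
      have h8 := congrArg natDegree h6
      rw [natDegree_C_mul (by norm_num)] at h8
      have h9 : (C (-2) * (C (s.coeff 0) * X) - C ((s ^ 2).coeff 0) : K[X]).natDegree ≤ 1 := by
        compute_degree
      omega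
    rw [h7, mul_zero] at h6
    have h8 := congrArg (fun p => p.coeff 1) h6
    simpa using h8
  obtain ⟨g, rfl⟩ : ∃ g, s = C 2 * (X * g) := by
    refine ⟨C (1 / 2) * s.divX, ?_⟩
    nth_rewrite 1 [← divX_mul_X_add s]
    rw [hs0, C_0, add_zero]
    have : (C 2 : K[X]) * C (1 / 2) = 1 := by rw [← C_mul]; norm_num
    linear_combination -s.divX * X * this
  have hs2 : aeval (pf K lam) (C 2 * (X * g)) = 2 * (pf K lam * aeval (pf K lam) g) := by
    rw [map_mul, map_mul, aeval_C, aeval_X, map_ofNat]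
  refine ⟨c, g, hc, hq', by rw [hH, hs2], ?_⟩
  apply pf_mul_cancel
  have h5 : (algebraMap K (PQ K lam) (1 / 4)) * 4 = 1 := by
    rw [← map_ofNat (algebraMap K (PQ K lam)) 4, ← map_mul]
    norm_num
  rw [map_pow, hs2] at h4
  linear_combination algebraMap K (PQ K lam) (1 / 4) * h4 -
    ((c • φ.val (pe K lam) - pe K lam + aeval (pf K lam) g * ph K lam +
        pf K lam * aeval (pf K lam) g ^ 2) * pf K lam) * h5

section triangular

variable {B : PoissonBr K lam} {Δ : K[X] → ↥(PAut B)} (hΔ : ∀ g, IsDelta B g (Δ g))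
  {HR : Kˣ → ↥(PAut B)} (hHR : ∀ β, IsHRot B β (HR β))

include hΔ hHR

theorem exists_eq_delta_mul_hrot (φ : ↥(PAut B)) {q : K[X]}
    (hq : φ.val (pf K lam) = aeval (pf K lam) q) : ∃ g β, φ = Δ g * HR β := by
  obtain ⟨c, g, hc, hf, hh, he⟩ := exists_of_map_pf φ hq
  obtain ⟨d1, d2, d3⟩ := hΔ g
  obtain ⟨r1, r2, r3⟩ := hHR (Units.mk0 c hc)⁻¹
  refine ⟨g, (Units.mk0 c hc)⁻¹, PAut.ext ?_ ?_ ?_⟩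
  · rw [PAut.mul_apply, r1, map_smul, d1, ← he, smul_smul]
    simp [hc]
  · rw [PAut.mul_apply, r2, d2, hh]
  · rw [PAut.mul_apply, r3, map_smul, d3, hf]
    simp

theorem mem_Tsub_iff (φ : ↥(PAut B)) :
    φ ∈ Tsub B Δ HR ↔ ∃ c : K, c ≠ 0 ∧ φ.val (pf K lam) = c • pf K lam := by
  constructor
  · intro h
    induction h using Subgroup.closure_induction with
    | mem x hx =>
      rcases hx with ⟨g, rfl⟩ | ⟨β, rfl⟩
      · exact ⟨1, one_ne_zero, by rw [(hΔ g).2.2, one_smul]⟩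
      · exact ⟨_, inv_ne_zero β.ne_zero, (hHR β).2.2⟩
    | one => exact ⟨1, one_ne_zero, by rw [PAut.one_apply, one_smul]⟩
    | mul x y _ _ hx hy =>
      obtain ⟨c, hc, hx⟩ := hx
      obtain ⟨d, hd, hy⟩ := hy
      exact ⟨d * c, mul_ne_zero hd hc, by rw [PAut.mul_apply, hy, map_smul, hx, smul_smul]⟩
    | inv x _ hx =>
      obtain ⟨c, hc, hx⟩ := hx
      refine ⟨c⁻¹, inv_ne_zero hc, ?_⟩
      apply x.val.injective
      rw [PAut.apply_inv_apply, map_smul, hx, smul_smul, inv_mul_cancel₀ hc, one_smul]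
  · rintro ⟨c, -, h⟩
    obtain ⟨g, β, rfl⟩ := exists_eq_delta_mul_hrot hΔ hHR φ (q := C c * X)
      (by rw [h, map_mul, aeval_C, aeval_X, PQ.smul_eq])
    exact mul_mem (Subgroup.subset_closure (Or.inl ⟨g, rfl⟩))
      (Subgroup.subset_closure (Or.inr ⟨β, rfl⟩))

end triangular

/-- The linear span of `e`, `h`, `f`. -/
def linSpan (K : Type*) [Field K] [IsAlgClosed K] [CharZero K] (lam : K) : Submodule K (PQ K lam) :=
  Submodule.span K {pe K lam, ph K lam, pf K lam}

theorem pe_mem_linSpan : pe K lam ∈ linSpan K lam := Submodule.subset_span (by simp)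
theorem ph_mem_linSpan : ph K lam ∈ linSpan K lam := Submodule.subset_span (by simp)
theorem pf_mem_linSpan : pf K lam ∈ linSpan K lam := Submodule.subset_span (by simp)

theorem exists_of_mem_linSpan {F : PQ K lam} (h : F ∈ linSpan K lam) :
    ∃ x y z : K, F = x • pe K lam + y • ph K lam + z • pf K lam := by
  obtain ⟨x, y, z, h⟩ := Submodule.mem_span_triple.1 h
  exact ⟨x, y, z, h.symm⟩

theorem Asub_map_mem {B : PoissonBr K lam} {φ : ↥(PAut B)} (h : φ ∈ Asub B) {F : PQ K lam}
    (hF : F ∈ linSpan K lam) : φ.val F ∈ linSpan K lam := by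
  have h1 : φ.val '' (linSpan K lam : Set (PQ K lam)) = linSpan K lam := h
  have h2 : φ.val F ∈ φ.val '' (linSpan K lam : Set (PQ K lam)) := ⟨F, hF, rfl⟩
  rwa [h1] at h2

theorem mem_Asub_of_mem {B : PoissonBr K lam} {φ : ↥(PAut B)}
    (he : φ.val (pe K lam) ∈ linSpan K lam) (hh : φ.val (ph K lam) ∈ linSpan K lam)
    (hf : φ.val (pf K lam) ∈ linSpan K lam) : φ ∈ Asub B := by
  have h1 : (linSpan K lam).map φ.val.toLinearMap ≤ linSpan K lam := by
    rw [linSpan, Submodule.map_span, Submodule.span_le]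
    rintro _ ⟨x, hx, rfl⟩
    rcases hx with rfl | rfl | rfl
    exacts [he, hh, hf]
  have : FiniteDimensional K (linSpan K lam) := by
    rw [linSpan]
    exact FiniteDimensional.span_of_finite K (by simp)
  have h2 := Submodule.eq_of_le_of_finrank_eq h1 (LinearEquiv.finrank_map_eq φ.val.toLinearEquiv _)
  show φ.val '' (linSpan K lam : Set (PQ K lam)) = linSpan K lam
  conv_rhs => rw [← h2]
  rfl

theorem tau_mem_Asub (B : PoissonBr K lam) : tau B ∈ Asub B := by
  obtain ⟨h1, h2, h3⟩ := tau_isTau B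
  refine mem_Asub_of_mem ?_ ?_ ?_
  · rw [h1]; exact pf_mem_linSpan
  · rw [h2]; exact neg_mem ph_mem_linSpan
  · rw [h3]; exact pe_mem_linSpan

section triangular

variable {B : PoissonBr K lam} {Δ : K[X] → ↥(PAut B)} (hΔ : ∀ g, IsDelta B g (Δ g))
  {HR : Kˣ → ↥(PAut B)} (hHR : ∀ β, IsHRot B β (HR β))

include hΔ hHR

theorem Asub_inf_Tsub : ((Asub B ⊓ Tsub B Δ HR : Subgroup ↥(PAut B)) : Set ↥(PAut B)) = CsetLT B := by
  ext φ
  constructor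
  · rintro ⟨hA, hT⟩
    obtain ⟨c, hc, hf⟩ := (mem_Tsub_iff hΔ hHR φ).1 hT
    obtain ⟨g, β, rfl⟩ := exists_eq_delta_mul_hrot hΔ hHR φ (q := C c * X)
      (by rw [hf, map_mul, aeval_C, aeval_X, PQ.smul_eq])
    obtain ⟨d1, d2, d3⟩ := hΔ g
    obtain ⟨r1, r2, r3⟩ := hHR β
    obtain ⟨x, y, z, h⟩ := exists_of_mem_linSpan (Asub_map_mem hA ph_mem_linSpan)
    rw [PAut.mul_apply, r2, d2] at h
    have hg : ∀ n, g.coeff (n + 1) = 0 := by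
      intro n
      have h1 : ph K lam + (2 : K) • (aeval (pf K lam) g * pf K lam) =
          x • pe K lam + y • ph K lam + z • pf K lam := by
        rw [← h, PQ.smul_eq, map_ofNat]; ring
      have h2 := congrArg (fun F => cf F (n + 2)) h1
      simp only [cf_add, cf_smul, cf_mul_pf, cf_pe, cf_ph, cf_pf, cf_aeval_pf] at h2
      rw [if_neg (by omega), if_neg (by omega), if_neg (by omega), if_neg (by omega),
        show ((n : ℤ) + 2 - 1).toNat = n + 1 by omega] at h2
      simpa using h2
    obtain ⟨a, rfl⟩ : ∃ a, g = C a := ⟨g.coeff 0, by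
      ext n
      rcases n with _ | n
      · simp
      · rw [hg, coeff_C_succ]⟩
    rw [aeval_C] at d1 d2
    have hβ : (β : K) ≠ 0 := β.ne_zero
    have e1 : (-(β : K) * a) ^ 2 / β = β * a ^ 2 := by field_simp
    have e2 : 2 * (-(β : K) * a) / β = -2 * a := by field_simp
    refine ⟨-β * a, β, ?_, ?_, ?_⟩
    · rw [PAut.mul_apply, r1, map_smul, d1, e1]
      simp only [PQ.smul_eq, map_mul, map_neg, map_pow]
      ring
    · rw [PAut.mul_apply, r2, d2, e2]
      simp only [PQ.smul_eq, map_mul, map_neg, map_ofNat]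
      ring
    · rw [PAut.mul_apply, r3, map_smul, d3]
  · rintro ⟨α, β, he, hh, hf⟩
    refine ⟨mem_Asub_of_mem ?_ ?_ ?_, (mem_Tsub_iff hΔ hHR φ).2 ⟨_, inv_ne_zero β.ne_zero, hf⟩⟩
    · rw [he]
      exact sub_mem (add_mem (Submodule.smul_mem _ _ pe_mem_linSpan)
        (Submodule.smul_mem _ _ ph_mem_linSpan)) (Submodule.smul_mem _ _ pf_mem_linSpan)
    · rw [hh]
      exact sub_mem ph_mem_linSpan (Submodule.smul_mem _ _ pf_mem_linSpan)
    · rw [hf]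
      exact Submodule.smul_mem _ _ pf_mem_linSpan

end triangular

end

section

open Polynomial Lau

/-- The degree in `f` of the nonnegative part of the expansion of `F`. -/
def tdeg (F : PQ K lam) : ℕ := (emb 1 0 F).coeff.support.sup Int.toNat

theorem cf_eq_zero_of_tdeg_lt {F : PQ K lam} {b : ℤ} (h : (tdeg F : ℤ) < b) : cf F b = 0 := by
  by_contra hb
  have h1 : b.toNat ≤ tdeg F := Finset.le_sup (f := Int.toNat) (Finsupp.mem_support_iff.2 hb)
  omega

theorem cf_tdeg_ne_zero {F : PQ K lam} (h : tdeg F ≠ 0) : cf F (tdeg F) ≠ 0 := by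
  have hne : (emb 1 0 F).coeff.support.Nonempty := by
    by_contra h1
    rw [Finset.not_nonempty_iff_eq_empty] at h1
    exact h (by rw [tdeg, h1]; rfl)
  obtain ⟨b, hb, hb'⟩ := Finset.exists_mem_eq_sup _ hne Int.toNat
  have h1 : tdeg F = b.toNat := hb'
  rw [h1] at h ⊢
  rw [show ((b.toNat : ℕ) : ℤ) = b by omega]
  exact Finsupp.mem_support_iff.1 hb

theorem tauHom_tauHom (F : PQ K lam) : PQ.tauHom (PQ.tauHom F) = F :=
  DFunLike.congr_fun PQ.tauHom_comp F

theorem cf_eq_zero_of_lt_neg_tdeg {F : PQ K lam} {b : ℤ} (h : b < -tdeg (PQ.tauHom F)) :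
    cf F b = 0 := by
  obtain ⟨i, rfl⟩ : ∃ i : ℕ, b = -i := ⟨(-b).toNat, by omega⟩
  rw [(cf_tauHom F i).2, cf_eq_zero_of_tdeg_lt (by omega), zero_comp, zero_mul]

theorem exists_of_coeff_emb_ne_zero {α : ℤ} (hα : α ≠ 0) {r : ℤ} {F : PQ K lam} {w : ℤ} {a : ℕ}
    (h : ((emb α r F).coeff w).coeff a ≠ 0) : ∃ b : ℤ, α * b + r * a = w ∧ (cf F b).coeff a ≠ 0 := by
  obtain ⟨b, rfl⟩ := exists_of_coeff_coeff_emb_ne_zero α r F h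
  exact ⟨b, rfl, by rwa [coeff_coeff_emb hα] at h⟩

theorem le_of_coeff_cf_ne_zero {α : ℤ} (hα : α ≠ 0) {r : ℤ} {F : PQ K lam} {W : ℤ}
    (hW : TopLE (emb α r F) W) {b : ℤ} {a : ℕ} (h : (cf F b).coeff a ≠ 0) : α * b + r * a ≤ W := by
  apply hW.le
  intro h0
  rw [← coeff_coeff_emb hα r, h0] at h
  exact h rfl

theorem exists_eq_C_of_forall_not_isRoot {p : K[X]} (h : ∀ c, ¬p.IsRoot c) : ∃ c, p = C c := by
  by_contra h1
  obtain ⟨c, hc⟩ := IsAlgClosed.exists_root p fun h2 => h1 ⟨_, eq_C_of_degree_eq_zero h2⟩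
  exact h c hc

section aut

variable {B : PoissonBr K lam} (φ : ↥(PAut B))

theorem order_relation_map_pf {α : ℤ} (hα : α ≠ 0) {r W : ℤ}
    (hW : TopLE (emb α r (φ.val (pf K lam))) W)
    (h0 : (emb α r (φ.val (pf K lam))).coeff W ≠ 0) {c : K}
    (hc : ((emb α r (φ.val (pf K lam))).coeff W).IsRoot c) (x : PQ K lam) {w : ℤ} {ν : ℕ} {ψ : K[X]}
    (hB : TopLE (emb α r x) w) (hψ : ψ.eval c ≠ 0)
    (hBw : (emb α r x).coeff w = (X - C c) ^ ν * ψ) :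
    ∃ j : ℕ, (((emb α r (φ.val (pf K lam))).coeff W).rootMultiplicity c : ℤ) * w - W * ν +
      j * (W - r * ((emb α r (φ.val (pf K lam))).coeff W).rootMultiplicity c) = 0 := by
  obtain ⟨k, hk⟩ := exists_iterate_poisson φ hα r x
  obtain ⟨q, hq, hq'⟩ := exists_eq_pow_rootMultiplicity_mul_and_not_dvd _ h0 c
  have hpos := (rootMultiplicity_pos h0).2 hc
  obtain ⟨μ, hμ⟩ := Nat.exists_eq_add_of_le' hpos
  rw [hμ] at hq ⊢
  exact order_relation hα hW (fun h => hq' (dvd_iff_isRoot.2 h)) hq k hB hψ hBw hk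

theorem order_relation_pf {α : ℤ} (hα : α ≠ 0) {r W : ℤ}
    (hW : TopLE (emb α r (φ.val (pf K lam))) W)
    (h0 : (emb α r (φ.val (pf K lam))).coeff W ≠ 0) {c : K}
    (hc : ((emb α r (φ.val (pf K lam))).coeff W).IsRoot c) :
    ∃ j : ℕ, (((emb α r (φ.val (pf K lam))).coeff W).rootMultiplicity c : ℤ) * α +
      j * (W - r * ((emb α r (φ.val (pf K lam))).coeff W).rootMultiplicity c) = 0 := by
  obtain ⟨j, hj⟩ := order_relation_map_pf φ hα hW h0 hc (pf K lam) (w := α) (ν := 0) (ψ := 1)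
    (by rw [emb_pf]; exact topLE_single _ _) (by simp)
    (by rw [emb_pf, coeff_single_eq, if_pos rfl]; simp)
  exact ⟨j, by simpa using hj⟩

theorem map_pf_ne_zero : φ.val (pf K lam) ≠ 0 := by
  intro h
  have h1 : pf K lam = 0 := by rwa [map_eq_zero_iff _ φ.val.injective] at h
  have h2 := cf_pf (K := K) (lam := lam) 1
  rw [h1, cf_zero] at h2
  simp at h2

theorem cf_tdeg_map_pf (h : tdeg (φ.val (pf K lam)) ≠ 0) :
    ∃ q : K, q ≠ 0 ∧ cf (φ.val (pf K lam)) (tdeg (φ.val (pf K lam))) = C q := by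
  have h0 := cf_tdeg_ne_zero h
  obtain ⟨q, hq⟩ := exists_eq_C_of_forall_not_isRoot
    (p := cf (φ.val (pf K lam)) (tdeg (φ.val (pf K lam)))) (by
      intro c hc
      obtain ⟨j, hj⟩ := order_relation_pf φ one_ne_zero (r := 0) (W := tdeg (φ.val (pf K lam)))
        (fun b hb => cf_eq_zero_of_tdeg_lt hb) h0 hc
      have hpos := (rootMultiplicity_pos h0).2 hc
      rw [zero_mul, sub_zero, mul_one] at hj
      have : (0 : ℤ) ≤ j * (tdeg (φ.val (pf K lam)) : ℤ) := by positivity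
      have hpos' : (0 : ℤ) < rootMultiplicity c (cf (φ.val (pf K lam)) (tdeg (φ.val (pf K lam)))) := by
        exact_mod_cast hpos
      unfold cf at hpos'
      omega)
  exact ⟨q, by rintro rfl; simp [hq] at h0, hq⟩

theorem cf_neg_tdeg_map_pf (h : tdeg (PQ.tauHom (φ.val (pf K lam))) ≠ 0) :
    ∃ q : K, q ≠ 0 ∧ cf (φ.val (pf K lam)) (-tdeg (PQ.tauHom (φ.val (pf K lam)))) =
      C q * disc lam ^ tdeg (PQ.tauHom (φ.val (pf K lam))) := by
  obtain ⟨q, hq, hq'⟩ := cf_tdeg_map_pf (tau B * φ) h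
  refine ⟨q, hq, ?_⟩
  have h1 : cf (PQ.tauHom (φ.val (pf K lam))) (tdeg (PQ.tauHom (φ.val (pf K lam)))) = C q := hq'
  rw [(cf_tauHom _ _).2, h1, C_comp]

theorem coeff_natTrailing_ne_zero {p : K[X]} (hp : p ≠ 0) : p.coeff (p.rootMultiplicity 0) ≠ 0 := by
  rw [rootMultiplicity_eq_natTrailingDegree']
  exact trailingCoeff_nonzero_iff_nonzero.2 hp

theorem exists_map_pf_eq_aeval (h : tdeg (PQ.tauHom (φ.val (pf K lam))) = 0) :
    ∃ q : K[X], φ.val (pf K lam) = aeval (pf K lam) q := by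
  have hneg : ∀ b < 0, cf (φ.val (pf K lam)) b = 0 := fun b hb =>
    cf_eq_zero_of_lt_neg_tdeg (by omega)
  set n := tdeg (φ.val (pf K lam)) with hn
  obtain ⟨W, hW, h0⟩ := exists_topLE
    (fun h => map_pf_ne_zero φ (emb_injective one_ne_zero ((n : ℤ) + 1) (h.trans (map_zero _).symm)))
  have hWn : W ≤ n := by
    have h1 : ((emb 1 ((n : ℤ) + 1) (φ.val (pf K lam))).coeff W).coeff 0 ≠ 0 := by
      intro h1
      have hc : ((emb 1 ((n : ℤ) + 1) (φ.val (pf K lam))).coeff W).IsRoot 0 := by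
        rwa [IsRoot, ← coeff_zero_eq_eval_zero]
      obtain ⟨j, hj⟩ := order_relation_pf φ one_ne_zero hW h0 hc
      have hpos := (rootMultiplicity_pos h0).2 hc
      obtain ⟨b, hb, hb'⟩ := exists_of_coeff_emb_ne_zero one_ne_zero (coeff_natTrailing_ne_zero h0)
      have hb0 : 0 ≤ b := by
        by_contra hb0
        rw [hneg b (by omega)] at hb'
        exact hb' rfl
      generalize rootMultiplicity 0 ((emb 1 ((n : ℤ) + 1) (φ.val (pf K lam))).coeff W) = μ at *
      rw [show W - ((n : ℤ) + 1) * μ = b by linear_combination -hb] at hj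
      have : (0 : ℤ) ≤ j * b := by positivity
      omega
    obtain ⟨b, hb, hb'⟩ := exists_of_coeff_emb_ne_zero one_ne_zero h1
    by_contra hWn
    rw [cf_eq_zero_of_tdeg_lt (by push_cast at hb; omega)] at hb'
    exact hb' rfl
  refine exists_aeval_pf hneg fun b => ⟨_, eq_C_of_natDegree_eq_zero ?_⟩
  rw [← Nat.le_zero, natDegree_le_iff_coeff_eq_zero]
  intro a ha
  by_contra h1
  have h2 := le_of_coeff_cf_ne_zero one_ne_zero hW h1
  have hb0 : 0 ≤ b := by
    by_contra hb0
    rw [hneg b (by omega)] at h1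
    exact h1 rfl
  have : ((n : ℤ) + 1) * 1 ≤ ((n : ℤ) + 1) * a := by
    apply mul_le_mul_of_nonneg_left <;> omega
  omega

end aut

end

section

open Polynomial Lau AddMonoidAlgebra

theorem emb_isDelta {B : PoissonBr K lam} {γ : K} {m : ℕ} {D : ↥(PAut B)}
    (hD : IsDelta B (C γ * X ^ m) D) {α r : ℤ} (hr : r = α * (m + 1)) (F : PQ K lam) (w : ℤ) :
    (emb α r (D.val F)).coeff w = ((emb α r F).coeff w).comp (X + C (2 * γ)) := by
  obtain ⟨he, hh, hf⟩ := hD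
  have hg : emb α r (aeval (pf K lam) (C γ * X ^ m)) = single (α * m) (C γ) := by
    rw [map_mul (aeval (pf K lam)), map_mul (emb α r), aeval_C, aeval_X_pow, map_pow, emb_pf,
      AlgHom.commutes, algebraMap_eq_single, single_pow, single_mul_single,
      one_pow, mul_one, zero_add, nsmul_eq_mul, mul_comm α]
  have h2 : (2 : Lau K) = single 0 (C 2) := by rw [← algebraMap_eq_single, map_ofNat]
  have key : (emb α r).comp (D.val : PQ K lam →ₐ[K] PQ K lam) =
      (mapAlgHom ℤ (aeval (X + C (2 * γ)) : K[X] →ₐ[K] K[X])).comp (emb α r) := by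
    apply PQ.algHom_ext
    · show emb α r (D.val (pe K lam)) = mapAlgHom ℤ (aeval (X + C (2 * γ))) (emb α r (pe K lam))
      rw [he, map_sub (emb α r), map_sub (emb α r), map_mul (emb α r) (aeval _ _),
        map_mul (emb α r) (pf K lam), map_pow (emb α r), hg, emb_pe, emb_ph, emb_pf, map_sub,
        mapAlgHom_single, mapAlgHom_single, single_pow, single_mul_single, single_mul_single]
      rw [show α * m + r = 2 * r - α by rw [hr]; ring,
        show α + 2 • (α * (m : ℤ)) = 2 * r - α by rw [hr, two_nsmul]; ring, sub_sub, sub_sub,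
        ← single_add, ← single_add, aeval_C, map_mul, aeval_C, aeval_X_pow, algebraMap_eq]
      have h3 : (C (1 / 4) * X ^ 2 + (C γ * X + 1 * C γ ^ 2) : K[X]) =
          C (1 / 4) * (X + C (2 * γ)) ^ 2 := by
        have h4 : (C (1 / 4) : K[X]) * 4 = 1 := by
          rw [show (4 : K[X]) = C 4 from (map_ofNat C 4).symm, ← C_mul]; norm_num
        rw [C_mul, map_ofNat C 2]
        linear_combination -(C γ * X + C γ ^ 2) * h4
      rw [← h3]
    · show emb α r (D.val (ph K lam)) = mapAlgHom ℤ (aeval (X + C (2 * γ))) (emb α r (ph K lam))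
      rw [hh, map_add (emb α r), map_mul (emb α r) 2, map_mul (emb α r) (pf K lam), hg, emb_ph,
        emb_pf, map_ofNat, h2, mapAlgHom_single, single_mul_single, single_mul_single, aeval_X,
        show 0 + (α + α * (m : ℤ)) = r by rw [hr]; ring, ← single_add, one_mul, ← C_mul]
    · show emb α r (D.val (pf K lam)) = mapAlgHom ℤ (aeval (X + C (2 * γ))) (emb α r (pf K lam))
      rw [hf, emb_pf, mapAlgHom_single, map_one]
  have h := DFunLike.congr_fun key F
  rw [AlgHom.comp_apply, AlgHom.comp_apply] at h
  rw [show emb α r (D.val F) = _ from h, coeff_mapAlgHom]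
  rfl

theorem eq_C_mul_X_sub_C_pow {p : K[X]} {c : K} (h : ∀ x ∈ p.roots, x = c) :
    p = C p.leadingCoeff * (X - C c) ^ p.natDegree := by
  have h1 := (IsAlgClosed.splits p).eq_prod_roots
  rw [Multiset.eq_replicate_of_mem h, Multiset.map_replicate, Multiset.prod_replicate,
    ← (IsAlgClosed.splits p).natDegree_eq_card_roots] at h1
  exact h1

theorem rootMultiplicity_add_le {p : K[X]} {x y : K} (h : x ≠ y) :
    p.rootMultiplicity x + p.rootMultiplicity y ≤ p.natDegree := by
  classical
  refine le_trans ?_ (card_roots' p)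
  rw [← count_roots, ← count_roots, ← Multiset.card_replicate (p.roots.count x) x,
    ← Multiset.card_replicate (p.roots.count y) y, ← Multiset.card_add]
  apply Multiset.card_le_card
  rw [Multiset.le_iff_count]
  intro z
  rw [Multiset.count_add, Multiset.count_replicate, Multiset.count_replicate]
  split_ifs with h1 h2 h2
  · exact absurd (h1.trans h2.symm) h
  · rw [h1]; simp
  · rw [h2]; simp
  · simp

theorem coeff_C_mul_disc_pow {q : K} (hq : q ≠ 0) (k : ℕ) :
    (C q * disc lam ^ k).coeff (2 * k) ≠ 0 := by
  have h : (disc lam ^ k).natDegree = 2 * k := by rw [natDegree_pow, natDegree_disc, mul_comm]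
  rw [coeff_C_mul, ← h]
  exact mul_ne_zero hq (leadingCoeff_ne_zero.2 (pow_ne_zero _ disc_ne_zero))

theorem exists_coeff_emb_map_pf {B : PoissonBr K lam} (φ : ↥(PAut B)) {n k : ℕ}
    (hn : tdeg (φ.val (pf K lam)) = n) (hk : tdeg (PQ.tauHom (φ.val (pf K lam))) = k)
    (hk0 : 0 < k) (hkn : k ≤ n) :
    ∃ (q c : K) (m : ℕ), n + k = 2 * k * (m + 1) ∧
      TopLE (emb (2 * k) (n + k) (φ.val (pf K lam))) (2 * k * n) ∧
      (emb (2 * k) (n + k) (φ.val (pf K lam))).coeff (2 * k * n) = C q * (X - C c) ^ (2 * k) := by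
  obtain ⟨α, hα⟩ : ∃ α : ℤ, α = 2 * k := ⟨_, rfl⟩
  obtain ⟨r, hr⟩ : ∃ r : ℤ, r = n + k := ⟨_, rfl⟩
  rw [← hα, ← hr]
  have hα0 : α ≠ 0 := by omega
  obtain ⟨W, hW, h0⟩ := exists_topLE
    (fun h => map_pf_ne_zero φ (emb_injective hα0 r (h.trans (map_zero _).symm)))
  have hle : ∀ {b : ℤ} {a : ℕ}, (cf (φ.val (pf K lam)) b).coeff a ≠ 0 → α * b + r * a ≤ W :=
    fun h => le_of_coeff_cf_ne_zero hα0 hW h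
  have hex : ∀ {a : ℕ}, ((emb α r (φ.val (pf K lam))).coeff W).coeff a ≠ 0 →
      ∃ b : ℤ, α * b + r * a = W ∧ (cf (φ.val (pf K lam)) b).coeff a ≠ 0 :=
    fun h => exists_of_coeff_emb_ne_zero hα0 h
  have hbn : ∀ {b : ℤ} {a : ℕ}, (cf (φ.val (pf K lam)) b).coeff a ≠ 0 → b ≤ n := by
    intro b a h
    by_contra hb
    rw [cf_eq_zero_of_tdeg_lt (by omega)] at h
    exact h rfl
  have hbk : ∀ {b : ℤ} {a : ℕ}, (cf (φ.val (pf K lam)) b).coeff a ≠ 0 → -k ≤ b := by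
    intro b a h
    by_contra hb
    rw [cf_eq_zero_of_lt_neg_tdeg (by omega)] at h
    exact h rfl
  have htop : (cf (φ.val (pf K lam)) n).coeff 0 ≠ 0 := by
    obtain ⟨q, hq, hq'⟩ := cf_tdeg_map_pf φ (by omega)
    rw [hn] at hq'
    rw [hq', coeff_C_zero]
    exact hq
  have hbot : (cf (φ.val (pf K lam)) (-k)).coeff (2 * k) ≠ 0 := by
    obtain ⟨q, hq, hq'⟩ := cf_neg_tdeg_map_pf φ (by omega)
    rw [hk] at hq'
    rw [hq']
    exact coeff_C_mul_disc_pow hq k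
  have hWge : α * n ≤ W := by
    have := hle htop
    push_cast at this
    linarith
  have hroot : ∀ {c : K}, ((emb α r (φ.val (pf K lam))).coeff W).IsRoot c →
      W < r * ((emb α r (φ.val (pf K lam))).coeff W).rootMultiplicity c := by
    intro c hc
    obtain ⟨j, hj⟩ := order_relation_pf φ hα0 hW h0 hc
    have hpos := (rootMultiplicity_pos h0).2 hc
    generalize rootMultiplicity c ((emb α r (φ.val (pf K lam))).coeff W) = μ at *
    by_contra h
    have h1 : (0 : ℤ) ≤ j * (W - r * μ) := mul_nonneg (by positivity) (by linarith)
    have h2 : (0 : ℤ) < μ * α := mul_pos (by exact_mod_cast hpos) (by omega)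
    linarith
  have h00 : W = α * n → ((emb α r (φ.val (pf K lam))).coeff W).coeff 0 ≠ 0 := by
    intro h
    have := coeff_coeff_emb hα0 r (φ.val (pf K lam)) n 0
    push_cast at this
    rw [mul_zero, add_zero, ← h] at this
    rwa [this]
  have hP0 : ((emb α r (φ.val (pf K lam))).coeff W).coeff 0 ≠ 0 := by
    by_contra hP0
    have hc : ((emb α r (φ.val (pf K lam))).coeff W).IsRoot 0 := by
      rwa [IsRoot, ← coeff_zero_eq_eval_zero]
    have hμ := hroot hc
    obtain ⟨b, hb, hb'⟩ := hex (coeff_natTrailing_ne_zero h0)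
    obtain ⟨j, hj⟩ := order_relation_map_pf φ hα0 hW h0 hc (pe K lam) (w := 2 * r - α) (ν := 2)
      (ψ := C (-(1 / 4)))
      (by
        rw [emb_pe]
        exact ((topLE_single _ _).mono (by omega)).sub (topLE_single _ _))
      (by rw [eval_C]; norm_num)
      (by
        rw [emb_pe, AddMonoidAlgebra.coeff_sub, Finsupp.sub_apply, coeff_single_eq, coeff_single_eq,
          if_neg (by omega), if_pos rfl, C_neg, C_0]
        ring)
    generalize rootMultiplicity 0 ((emb α r (φ.val (pf K lam))).coeff W) = μ at *
    have hbneg : b < 0 := by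
      by_contra h
      have : 0 ≤ α * b := mul_nonneg (by omega) (by omega)
      linarith
    obtain ⟨β, rfl⟩ : ∃ β : ℕ, b = -β := ⟨(-b).toNat, by omega⟩
    have hne : cf (φ.val (pf K lam)) (-β) ≠ 0 := fun h => hb' (by rw [h, Polynomial.coeff_zero])
    have hβk := hbk hb'
    have hdeg : (cf (φ.val (pf K lam)) (-β)).natDegree ≤ μ := by
      have h1 := hle (b := -β) (a := (cf (φ.val (pf K lam)) (-β)).natDegree)
        (leadingCoeff_ne_zero.2 hne)
      have h2 : r * (cf (φ.val (pf K lam)) (-β)).natDegree ≤ r * μ := by linarith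
      exact_mod_cast le_of_mul_le_mul_left h2 (by omega)
    have hdvd := natDegree_le_of_dvd (disc_pow_dvd_cf (φ.val (pf K lam)) β) hne
    rw [natDegree_pow, natDegree_disc] at hdvd
    have hrel : (k : ℤ) * (μ - β * (2 - j)) = 0 := by
      rw [← hb, hr, hα] at hj
      push_cast at hj
      linarith
    have hβ0 : 0 < (β : ℤ) := by omega
    have hμβ : (μ : ℤ) = β * (2 - j) := by
      rcases mul_eq_zero.1 hrel with h | h
      · omega
      · linarith
    have hμβ' : (β : ℤ) * 2 ≤ β * (2 - j) := by
      rw [← hμβ]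
      exact_mod_cast hdvd.trans hdeg
    have hj0 := le_of_mul_le_mul_left hμβ' hβ0
    obtain rfl : j = 0 := by omega
    apply h00 _ hP0
    apply le_antisymm _ hWge
    rw [← hb, hμβ, hr, hα]
    push_cast
    have : (n : ℤ) * β ≤ n * k := mul_le_mul_of_nonneg_left (by omega) (by omega)
    linarith
  have hWn : W = α * n := by
    obtain ⟨b, hb, hb'⟩ := hex hP0
    apply le_antisymm _ hWge
    have : α * b ≤ α * n := mul_le_mul_of_nonneg_left (hbn hb') (by omega)
    push_cast at hb
    linarith
  have hP2k : ((emb α r (φ.val (pf K lam))).coeff W).coeff (2 * k) ≠ 0 := by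
    have := coeff_coeff_emb hα0 r (φ.val (pf K lam)) (-k) (2 * k)
    rw [show α * -(k : ℤ) + r * ((2 * k : ℕ) : ℤ) = W by
      rw [hWn, hα, hr]; push_cast; ring] at this
    rwa [this]
  have hdeg : ((emb α r (φ.val (pf K lam))).coeff W).natDegree = 2 * k := by
    apply le_antisymm _ (le_natDegree_of_ne_zero hP2k)
    obtain ⟨b, hb, hb'⟩ := hex (leadingCoeff_ne_zero.2 h0)
    have h1 : α * -k ≤ α * b := mul_le_mul_of_nonneg_left (hbk hb') (by omega)
    have h2 : r * ((emb α r (φ.val (pf K lam))).coeff W).natDegree ≤ r * (2 * k : ℕ) := by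
      push_cast
      have : r * (2 * k) = α * n + α * k := by rw [hr, hα]; ring
      linarith
    exact_mod_cast le_of_mul_le_mul_left h2 (by omega)
  obtain ⟨c, hc⟩ := IsAlgClosed.exists_root ((emb α r (φ.val (pf K lam))).coeff W) (by
    rw [degree_eq_natDegree h0, hdeg]
    exact_mod_cast (by omega : 2 * k ≠ 0))
  have hP := eq_C_mul_X_sub_C_pow (p := (emb α r (φ.val (pf K lam))).coeff W) (c := c) (by
    intro x hx
    by_contra hxc
    have h1 := hroot (isRoot_of_mem_roots hx)
    have h2 := hroot hc
    have h3 : r * ((((emb α r (φ.val (pf K lam))).coeff W).rootMultiplicity x +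
      ((emb α r (φ.val (pf K lam))).coeff W).rootMultiplicity c : ℕ) : ℤ) ≤ r * (2 * k : ℕ) :=
        mul_le_mul_of_nonneg_left (by exact_mod_cast hdeg ▸ rootMultiplicity_add_le hxc) (by omega)
    push_cast at h3
    have h4 : r * (2 * k) = α * n + α * k := by rw [hr, hα]; ring
    have h5 : α * k ≤ α * n := mul_le_mul_of_nonneg_left (by omega) (by omega)
    linarith)
  rw [hdeg] at hP
  generalize hq : ((emb α r (φ.val (pf K lam))).coeff W).leadingCoeff = q at hP
  have hq0 : q ≠ 0 := hq ▸ leadingCoeff_ne_zero.2 h0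
  have hc0 : c ≠ 0 := by
    rintro rfl
    rw [hP, C_0, sub_zero, coeff_C_mul, coeff_X_pow, if_neg (by omega), mul_zero] at hP0
    exact hP0 rfl
  obtain ⟨b, hb, hb'⟩ := hex (a := 2 * k - 1) (by
    rw [hP, coeff_C_mul, sub_eq_add_neg, ← C_neg, coeff_X_add_C_pow]
    refine mul_ne_zero hq0 (mul_ne_zero (pow_ne_zero _ (neg_ne_zero.2 hc0)) ?_)
    exact_mod_cast (Nat.choose_pos (by omega)).ne')
  have hrel : r = α * (b + k) := by
    have h1 : ((2 * k - 1 : ℕ) : ℤ) = α - 1 := by omega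
    rw [h1, hWn] at hb
    have h2 : α * k + r * α = α * n + 2 * α * k := by rw [hr, hα]; ring
    rw [hr, hα] at hb ⊢
    linarith
  have hpos : 0 < b + k := by
    by_contra h
    have : α * (b + k) ≤ 0 := mul_nonpos_of_nonneg_of_nonpos (by omega) (by omega)
    omega
  obtain ⟨m, hm⟩ : ∃ m : ℕ, b + k = m + 1 := ⟨(b + k - 1).toNat, by omega⟩
  refine ⟨q, c, m, ?_, ?_, ?_⟩
  · rw [hm, hr, hα] at hrel
    exact_mod_cast hrel
  · rwa [← hWn]
  · rwa [← hWn]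

theorem exists_isDelta_tdeg_lt {B : PoissonBr K lam} (φ : ↥(PAut B)) {Δ : K[X] → ↥(PAut B)}
    (hΔ : ∀ g, IsDelta B g (Δ g)) (hk0 : 0 < tdeg (PQ.tauHom (φ.val (pf K lam))))
    (hkn : tdeg (PQ.tauHom (φ.val (pf K lam))) ≤ tdeg (φ.val (pf K lam))) :
    ∃ g, tdeg ((Δ g * φ).val (pf K lam)) < tdeg (φ.val (pf K lam)) ∧
      tdeg (PQ.tauHom ((Δ g * φ).val (pf K lam))) ≤ tdeg (PQ.tauHom (φ.val (pf K lam))) := by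
  obtain ⟨q, c, m, hm, hW, hP⟩ := exists_coeff_emb_map_pf φ rfl rfl hk0 hkn
  generalize hn : tdeg (φ.val (pf K lam)) = n at *
  generalize hk : tdeg (PQ.tauHom (φ.val (pf K lam))) = k at *
  obtain ⟨D, hD⟩ : ∃ D, D = Δ (C (c / 2) * X ^ m) * φ := ⟨_, rfl⟩
  have hα0 : (2 * k : ℤ) ≠ 0 := by omega
  have hemb (w : ℤ) : (emb (2 * k) (n + k) (D.val (pf K lam))).coeff w =
      ((emb (2 * k) (n + k) (φ.val (pf K lam))).coeff w).comp (X + C (2 * (c / 2))) := by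
    rw [hD]
    exact emb_isDelta (hΔ _) (by exact_mod_cast hm) _ _
  have hW' : TopLE (emb (2 * k) (n + k) (D.val (pf K lam))) (2 * k * n) := by
    intro w hw
    rw [hemb, hW w hw, zero_comp]
  have hP' : ((emb (2 * k) (n + k) (D.val (pf K lam))).coeff (2 * k * n)).coeff 0 = 0 := by
    rw [hemb, hP, mul_div_cancel₀ c two_ne_zero]
    simp [hk0.ne']
  refine ⟨C (c / 2) * X ^ m, ?_, ?_⟩
  · rw [← hD]
    by_contra h
    obtain ⟨q', hq', h1⟩ := cf_tdeg_map_pf D (by omega)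
    have h2 : (cf (D.val (pf K lam)) (tdeg (D.val (pf K lam)))).coeff 0 ≠ 0 := by
      rwa [h1, coeff_C_zero]
    have h3 := le_of_coeff_cf_ne_zero hα0 hW' h2
    push_cast at h3
    rw [mul_zero, add_zero] at h3
    have h4 := le_of_mul_le_mul_left h3 (by omega)
    rw [show tdeg (D.val (pf K lam)) = n by omega, ← coeff_coeff_emb hα0 (n + k)] at h2
    push_cast at h2
    rw [mul_zero, add_zero] at h2
    exact h2 hP'
  · rw [← hD]
    rcases Nat.eq_zero_or_pos (tdeg (PQ.tauHom (D.val (pf K lam)))) with h0 | h0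
    · omega
    obtain ⟨q', hq', h1⟩ := cf_neg_tdeg_map_pf D h0.ne'
    have h2 := coeff_C_mul_disc_pow (lam := lam) hq' (tdeg (PQ.tauHom (D.val (pf K lam))))
    rw [← h1] at h2
    have h3 := le_of_coeff_cf_ne_zero hα0 hW' h2
    push_cast at h3
    have h4 : (2 * n : ℤ) * tdeg (PQ.tauHom (D.val (pf K lam))) ≤ 2 * n * k := by linarith
    exact_mod_cast le_of_mul_le_mul_left h4 (by omega)

section generation

variable {B : PoissonBr K lam} {Δ : K[X] → ↥(PAut B)} {HR : Kˣ → ↥(PAut B)}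
  (hΔ : ∀ g, IsDelta B g (Δ g)) (hHR : ∀ β, IsHRot B β (HR β))

include hΔ hHR

theorem mem_Tsub_of_tdeg_eq_zero (φ : ↥(PAut B))
    (h : tdeg (PQ.tauHom (φ.val (pf K lam))) = 0) : φ ∈ Tsub B Δ HR := by
  obtain ⟨q, hq⟩ := exists_map_pf_eq_aeval φ h
  obtain ⟨g, β, rfl⟩ := exists_eq_delta_mul_hrot hΔ hHR φ hq
  exact mul_mem (Subgroup.subset_closure (Or.inl ⟨g, rfl⟩))
    (Subgroup.subset_closure (Or.inr ⟨β, rfl⟩))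

theorem mem_sup_of_tau_mul_mem {φ : ↥(PAut B)} (h : tau B * φ ∈ Asub B ⊔ Tsub B Δ HR) :
    φ ∈ Asub B ⊔ Tsub B Δ HR :=
  ((Asub B ⊔ Tsub B Δ HR).mul_mem_cancel_left
    ((le_sup_left : Asub B ≤ _) (tau_mem_Asub B))).1 h

theorem Asub_sup_Tsub : Asub B ⊔ Tsub B Δ HR = ⊤ := by
  rw [eq_top_iff]
  rintro φ -
  generalize hN : tdeg (φ.val (pf K lam)) + tdeg (PQ.tauHom (φ.val (pf K lam))) = N
  induction N using Nat.strong_induction_on generalizing φ with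
  | _ N ih =>
    have key : ∀ φ : ↥(PAut B),
        tdeg (φ.val (pf K lam)) + tdeg (PQ.tauHom (φ.val (pf K lam))) = N →
        tdeg (PQ.tauHom (φ.val (pf K lam))) ≤ tdeg (φ.val (pf K lam)) →
        φ ∈ Asub B ⊔ Tsub B Δ HR := by
      intro φ hN hle
      rcases Nat.eq_zero_or_pos (tdeg (PQ.tauHom (φ.val (pf K lam)))) with h0 | h0
      · exact (le_sup_right : Tsub B Δ HR ≤ _) (mem_Tsub_of_tdeg_eq_zero hΔ hHR φ h0)
      · obtain ⟨g, h1, h2⟩ := exists_isDelta_tdeg_lt φ hΔ h0 hle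
        have h3 := ih _ (by omega) (φ := Δ g * φ) rfl
        exact ((Asub B ⊔ Tsub B Δ HR).mul_mem_cancel_left ((le_sup_right : Tsub B Δ HR ≤ _)
          (Subgroup.subset_closure (Or.inl ⟨g, rfl⟩)))).1 h3
    rcases le_total (tdeg (PQ.tauHom (φ.val (pf K lam)))) (tdeg (φ.val (pf K lam))) with h | h
    · exact key φ hN h
    · apply mem_sup_of_tau_mul_mem hΔ hHR
      have h1 : (tau B * φ).val (pf K lam) = PQ.tauHom (φ.val (pf K lam)) := rfl
      apply key (tau B * φ)
      · rw [h1, tauHom_tauHom, add_comm, hN]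
      · rwa [h1, tauHom_tauHom]

end generation

end

section

open Polynomial Lau

section lead

variable {S : Type*} [CommRing S] [Algebra K S]

theorem add_pow_sub_pow_mem {P Q : Submodule K S} {x y : S} (hx : x ∈ P) (hy : y ∈ Q)
    (hQP : Q ≤ P) (N : ℕ) : (x + y) ^ (N + 1) - x ^ (N + 1) ∈ P ^ N * Q := by
  induction N with
  | zero => simpa using hy
  | succ N ih =>
    have h1 : (x + y) ^ (N + 1 + 1) - x ^ (N + 1 + 1) =
        (x + y) * ((x + y) ^ (N + 1) - x ^ (N + 1)) + x ^ (N + 1) * y := by ring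
    rw [h1]
    refine add_mem ?_ (Submodule.mul_mem_mul (Submodule.pow_mem_pow P hx _) hy)
    rw [pow_succ', mul_assoc]
    exact Submodule.mul_mem_mul (add_mem hx (hQP hy)) ih

/-- `F` is a nonzero multiple of `x ^ (N + 1)` up to an error in `P ^ N * Q`. -/
def IsLead (N : ℕ) (P Q : Submodule K S) (x F : S) : Prop :=
  ∃ c : K, c ≠ 0 ∧ F - c • x ^ (N + 1) ∈ P ^ N * Q

theorem IsLead.map {N : ℕ} {P Q P' Q' : Submodule K S} {x x' F : S} (h : IsLead N P Q x F)
    (t : S →ₐ[K] S) (hP : P.map t.toLinearMap ≤ P') (hQ : Q.map t.toLinearMap ≤ Q') {c : K}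
    (hc : c ≠ 0) (hx' : x' ∈ P') (hx : t x - c • x' ∈ Q') (hQP : Q' ≤ P') :
    IsLead N P' Q' x' (t F) := by
  obtain ⟨d, hd, h⟩ := h
  refine ⟨d * c ^ (N + 1), mul_ne_zero hd (pow_ne_zero _ hc), ?_⟩
  have h1 : t (F - d • x ^ (N + 1)) ∈ P' ^ N * Q' := by
    have h2 := Submodule.mem_map_of_mem (f := t.toLinearMap) h
    rw [Submodule.map_mul, Submodule.map_pow] at h2
    exact mul_le_mul' (pow_le_pow_left' hP N) hQ h2
  have h2 := add_pow_sub_pow_mem (P'.smul_mem c hx') hx hQP N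
  rw [add_sub_cancel, _root_.smul_pow] at h2
  have h3 := add_mem h1 ((P' ^ N * Q').smul_mem d h2)
  rw [map_sub, map_smul, map_pow, smul_sub, smul_smul, sub_add_sub_cancel] at h3
  exact h3

end lead

/-- `Submodule.span` with the module structure coming from an algebra structure. -/
def algSpan (K : Type*) {S : Type*} [Field K] [CommRing S] [Algebra K S] (s : Set S) :
    Submodule K S :=
  Submodule.span K s

/-- The span of `1`, `e`, `h`, `f`. -/
def affSpan (K : Type*) [Field K] [IsAlgClosed K] [CharZero K] (lam : K) :=
  algSpan K {1, pe K lam, ph K lam, pf K lam}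

/-- The span of `1`, `h`, `f`. -/
def borelSpan (K : Type*) [Field K] [IsAlgClosed K] [CharZero K] (lam : K) :=
  algSpan K {1, ph K lam, pf K lam}

theorem pe_mem_affSpan : pe K lam ∈ affSpan K lam := Submodule.subset_span (by simp)
theorem ph_mem_affSpan : ph K lam ∈ affSpan K lam := Submodule.subset_span (by simp)
theorem pf_mem_affSpan : pf K lam ∈ affSpan K lam := Submodule.subset_span (by simp)
theorem ph_mem_borelSpan : ph K lam ∈ borelSpan K lam := Submodule.subset_span (by simp)
theorem pf_mem_borelSpan : pf K lam ∈ borelSpan K lam := Submodule.subset_span (by simp)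

theorem one_le_borelSpan : 1 ≤ borelSpan K lam := by
  rw [Submodule.one_le]
  exact Submodule.subset_span (by simp)

theorem borelSpan_le_affSpan : borelSpan K lam ≤ affSpan K lam := by
  apply Submodule.span_mono
  intro x hx
  rcases hx with rfl | rfl | rfl <;> simp

theorem mem_affSpan_of_mem_linSpan {x : PQ K lam} (hx : x ∈ linSpan K lam) : x ∈ affSpan K lam :=
  Submodule.span_mono (Set.subset_insert _ _) hx

theorem one_le_affSpan : 1 ≤ affSpan K lam := one_le_borelSpan.trans borelSpan_le_affSpan

theorem one_mem_affSpan_pow (n : ℕ) : 1 ∈ affSpan K lam ^ n := by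
  rw [← Submodule.one_le]
  exact one_le_pow_of_one_le' one_le_affSpan n

theorem affSpan_pow_mono {i j : ℕ} (h : i ≤ j) : affSpan K lam ^ i ≤ affSpan K lam ^ j :=
  pow_le_pow_right' one_le_affSpan h

theorem topLE_of_mem_affSpan_pow {N : ℕ} : ∀ {F : PQ K lam}, F ∈ affSpan K lam ^ N →
    TopLE (emb 1 1 F) N := by
  induction N with
  | zero =>
    intro F hF
    rw [pow_zero, Submodule.mem_one] at hF
    obtain ⟨c, rfl⟩ := hF
    rw [AlgHom.commutes, algebraMap_eq_single]
    exact topLE_single _ _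
  | succ N ih =>
    intro F hF
    rw [pow_succ (affSpan K lam) N] at hF
    induction hF using Submodule.mul_induction_on' with
    | mem_mul_mem m hm n hn =>
      rw [map_mul (emb 1 1) m n]
      push_cast
      refine (ih hm).mul ?_
      induction hn using Submodule.span_induction with
      | mem x hx =>
        rcases hx with rfl | rfl | rfl | rfl
        · rw [map_one (emb 1 1)]
          exact (topLE_single 0 1).mono (by norm_num)
        · rw [emb_pe]
          exact ((topLE_single _ _).mono (by norm_num)).sub (topLE_single _ _)
        · rw [emb_ph]
          exact topLE_single _ _
        · rw [emb_pf]
          exact topLE_single _ _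
      | zero => rw [map_zero]; exact fun _ _ => rfl
      | add x y _ _ hx hy => rw [map_add]; exact hx.add hy
      | smul c x _ hx => rw [map_smul]; exact hx.smul c
    | add x _ y _ hx hy => rw [map_add]; exact hx.add hy

theorem pf_pow_notMem (N : ℕ) : pf K lam ^ (N + 1) ∉ affSpan K lam ^ N := by
  intro h
  have h1 := topLE_of_mem_affSpan_pow h (N + 1) (by omega)
  rw [map_pow (emb 1 1), emb_pf, AddMonoidAlgebra.single_pow, one_pow, coeff_single_eq,
    if_pos (by simp)] at h1
  exact one_ne_zero h1

/-- Leading term a multiple of `f ^ (N + 1)`. -/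
abbrev IsLeadF (N : ℕ) (F : PQ K lam) : Prop := IsLead N (affSpan K lam) 1 (pf K lam) F

/-- Leading term a multiple of `e ^ (N + 1)`. -/
abbrev IsLeadE (N : ℕ) (F : PQ K lam) : Prop :=
  IsLead N (affSpan K lam) (borelSpan K lam) (pe K lam) F

theorem IsLeadF.notMem_affSpan {N : ℕ} {F : PQ K lam} (h : IsLeadF N F) (hN : 1 ≤ N) :
    F ∉ affSpan K lam := by
  intro hF
  obtain ⟨c, hc, h⟩ := h
  rw [mul_one] at h
  have h1 : F ∈ affSpan K lam ^ N := affSpan_pow_mono hN (by rwa [pow_one])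
  have h2 := sub_mem h1 h
  rw [sub_sub_cancel] at h2
  exact pf_pow_notMem N (((affSpan K lam ^ N).smul_mem_iff hc).1 h2)

theorem isLeadF_pf : IsLeadF 0 (pf K lam) := ⟨1, one_ne_zero, by simp⟩

theorem isLeadE_pe : IsLeadE 0 (pe K lam) := ⟨1, one_ne_zero, by simp⟩

theorem map_affSpan_le {t : PQ K lam →ₐ[K] PQ K lam} {P : Submodule K (PQ K lam)} (h1 : 1 ∈ P)
    (he : t (pe K lam) ∈ P) (hh : t (ph K lam) ∈ P) (hf : t (pf K lam) ∈ P) :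
    (affSpan K lam).map t.toLinearMap ≤ P := by
  rw [affSpan, algSpan, Submodule.map_span, Submodule.span_le]
  rintro _ ⟨x, hx, rfl⟩
  rcases hx with rfl | rfl | rfl | rfl
  exacts [(map_one t).symm ▸ h1, he, hh, hf]

theorem map_borelSpan_le {t : PQ K lam →ₐ[K] PQ K lam} {P : Submodule K (PQ K lam)} (h1 : 1 ∈ P)
    (hh : t (ph K lam) ∈ P) (hf : t (pf K lam) ∈ P) :
    (borelSpan K lam).map t.toLinearMap ≤ P := by
  rw [borelSpan, algSpan, Submodule.map_span, Submodule.span_le]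
  rintro _ ⟨x, hx, rfl⟩
  rcases hx with rfl | rfl | rfl
  exacts [(map_one t).symm ▸ h1, hh, hf]

theorem aeval_pf_mem {g : K[X]} {d : ℕ} (h : g.natDegree ≤ d) :
    aeval (pf K lam) g ∈ affSpan K lam ^ d := by
  rw [aeval_eq_sum_range]
  refine sum_mem fun i hi => Submodule.smul_mem _ _ ?_
  have hi' : i ≤ d := by
    rw [Finset.mem_range] at hi
    omega
  exact affSpan_pow_mono hi' (Submodule.pow_mem_pow _ pf_mem_affSpan i)

theorem aeval_pf_sub_mem {g : K[X]} {m : ℕ} (h : g.natDegree = m + 1) :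
    aeval (pf K lam) g - g.leadingCoeff • pf K lam ^ (m + 1) ∈ affSpan K lam ^ m := by
  have h1 := congrArg (aeval (pf K lam)) g.eraseLead_add_C_mul_X_pow
  rw [map_add, map_mul, aeval_C, aeval_X_pow, h, ← PQ.smul_eq] at h1
  rw [← h1, add_sub_cancel_right]
  exact aeval_pf_mem (g.eraseLead_natDegree_le.trans (by omega))

section pingpong

variable {B : PoissonBr K lam} {Δ : K[X] → ↥(PAut B)} {HR : Kˣ → ↥(PAut B)}

theorem map_affSpan_of_mem_Asub {φ : ↥(PAut B)} (h : φ ∈ Asub B) {F : PQ K lam}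
    (hF : F ∈ affSpan K lam) : φ.val F ∈ affSpan K lam := by
  have h1 : (affSpan K lam).map (φ.val : PQ K lam →ₐ[K] PQ K lam).toLinearMap ≤ affSpan K lam :=
    map_affSpan_le (by simpa using one_mem_affSpan_pow 1)
      (mem_affSpan_of_mem_linSpan (Asub_map_mem h pe_mem_linSpan))
      (mem_affSpan_of_mem_linSpan (Asub_map_mem h ph_mem_linSpan))
      (mem_affSpan_of_mem_linSpan (Asub_map_mem h pf_mem_linSpan))
  exact h1 (Submodule.mem_map_of_mem hF)

variable (hΔ : ∀ g, IsDelta B g (Δ g)) (hHR : ∀ β, IsHRot B β (HR β))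

include hΔ hHR

theorem exists_map_pf_of_mem_Asub {φ : ↥(PAut B)} (hA : φ ∈ Asub B) (hT : φ ∉ Tsub B Δ HR) :
    ∃ c : K, c ≠ 0 ∧ φ.val (pf K lam) - c • pe K lam ∈ borelSpan K lam := by
  obtain ⟨x, y, z, hxyz⟩ := exists_of_mem_linSpan (Asub_map_mem hA pf_mem_linSpan)
  refine ⟨x, ?_, ?_⟩
  · rintro rfl
    apply hT
    apply mem_Tsub_of_tdeg_eq_zero hΔ hHR
    by_contra h
    apply cf_tdeg_ne_zero h
    generalize tdeg (PQ.tauHom (φ.val (pf K lam))) = d at *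
    rw [hxyz, map_add, map_add, map_smul, map_smul, map_smul, PQ.tauHom_pe, PQ.tauHom_ph,
      PQ.tauHom_pf, cf_add, cf_add, cf_smul, cf_smul, cf_smul, cf_neg, cf_pe, cf_ph,
      if_neg (show (0 : ℤ) ≠ d by omega), if_neg (show (-1 : ℤ) ≠ d by omega)]
    simp
  · rw [hxyz, add_assoc, add_sub_cancel_left]
    exact add_mem (Submodule.smul_mem _ _ ph_mem_borelSpan) (Submodule.smul_mem _ _ pf_mem_borelSpan)

theorem isLeadE_map {φ : ↥(PAut B)} (hA : φ ∈ Asub B) (hT : φ ∉ Tsub B Δ HR) {N : ℕ}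
    {F : PQ K lam} (hF : IsLeadF N F) : IsLeadE N (φ.val F) := by
  obtain ⟨c, hc, h⟩ := exists_map_pf_of_mem_Asub hΔ hHR hA hT
  refine hF.map (φ.val : PQ K lam →ₐ[K] PQ K lam) ?_ ?_ hc pe_mem_affSpan h borelSpan_le_affSpan
  · rintro _ ⟨x, hx, rfl⟩
    exact map_affSpan_of_mem_Asub hA hx
  · rintro _ ⟨x, hx, rfl⟩
    obtain ⟨d, rfl⟩ := Submodule.mem_one.1 hx
    rw [show (φ.val : PQ K lam →ₐ[K] PQ K lam).toLinearMap (algebraMap K (PQ K lam) d) =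
      algebraMap K (PQ K lam) d from φ.val.commutes d]
    exact one_le_borelSpan (Submodule.mem_one.2 ⟨d, rfl⟩)

theorem exists_isLeadF_map {φ : ↥(PAut B)} (hT : φ ∈ Tsub B Δ HR) (hA : φ ∉ Asub B) {N : ℕ}
    {F : PQ K lam} (hF : IsLeadE N F) : ∃ M, 1 ≤ M ∧ IsLeadF M (φ.val F) := by
  obtain ⟨c, hc, hcf⟩ := (mem_Tsub_iff hΔ hHR φ).1 hT
  obtain ⟨g, β, rfl⟩ := exists_eq_delta_mul_hrot hΔ hHR φ (q := C c * X)
    (by rw [hcf, map_mul, aeval_C, aeval_X, PQ.smul_eq])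
  obtain ⟨d1, d2, d3⟩ := hΔ g
  obtain ⟨r1, r2, r3⟩ := hHR β
  have he : (Δ g * HR β).val (pe K lam) = (β : K) • (pe K lam - aeval (pf K lam) g * ph K lam -
      pf K lam * aeval (pf K lam) g ^ 2) := by
    rw [PAut.mul_apply, r1, map_smul, d1]
  have hh : (Δ g * HR β).val (ph K lam) = ph K lam + 2 * (pf K lam * aeval (pf K lam) g) := by
    rw [PAut.mul_apply, r2, d2]
  rcases hd : g.natDegree with _ | m
  · exfalso
    apply hA
    obtain ⟨γ, rfl⟩ : ∃ γ, g = C γ := ⟨_, eq_C_of_natDegree_eq_zero hd⟩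
    rw [aeval_C] at he hh
    have e1 : algebraMap K (PQ K lam) γ * ph K lam = γ • ph K lam := (PQ.smul_eq _ _).symm
    have e2 : pf K lam * algebraMap K (PQ K lam) γ ^ 2 = γ ^ 2 • pf K lam := by
      rw [PQ.smul_eq, map_pow, mul_comm (pf K lam)]
    have e3 : 2 * (pf K lam * algebraMap K (PQ K lam) γ) = (2 * γ) • pf K lam := by
      rw [PQ.smul_eq, map_mul, map_ofNat, mul_comm (pf K lam), mul_assoc 2]
    rw [e1, e2] at he
    rw [e3] at hh
    apply mem_Asub_of_mem
    · rw [he]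
      exact Submodule.smul_mem _ _ (sub_mem (sub_mem pe_mem_linSpan
        (Submodule.smul_mem _ _ ph_mem_linSpan)) (Submodule.smul_mem _ _ pf_mem_linSpan))
    · rw [hh]
      exact add_mem ph_mem_linSpan (Submodule.smul_mem _ _ pf_mem_linSpan)
    · rw [hcf]
      exact Submodule.smul_mem _ _ pf_mem_linSpan
  have hle : ∀ {i : ℕ} {x : PQ K lam}, i ≤ 2 * m + 2 → x ∈ affSpan K lam ^ i →
      x ∈ affSpan K lam ^ (2 * m + 2) := fun hi hx => affSpan_pow_mono hi hx
  have hg : aeval (pf K lam) g ∈ affSpan K lam ^ (m + 1) := aeval_pf_mem hd.le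
  have hfm : g.leadingCoeff • pf K lam ^ (m + 1) ∈ affSpan K lam ^ (m + 1) :=
    Submodule.smul_mem _ _ (Submodule.pow_mem_pow _ pf_mem_affSpan _)
  have hmul : ∀ {i j : ℕ} {x y : PQ K lam}, x ∈ affSpan K lam ^ i → y ∈ affSpan K lam ^ j →
      x * y ∈ affSpan K lam ^ (i + j) := fun hx hy => by
    rw [pow_add]
    exact Submodule.mul_mem_mul hx hy
  have hone : ∀ {x : PQ K lam}, x ∈ affSpan K lam → x ∈ affSpan K lam ^ 1 := fun hx => by
    rwa [pow_one]
  have hh' : (Δ g * HR β).val (ph K lam) ∈ affSpan K lam ^ (2 * m + 2) := by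
    rw [hh, two_mul (pf K lam * aeval (pf K lam) g)]
    have h1 := hle (by omega) (hmul (hone pf_mem_affSpan) hg)
    exact add_mem (hle (by omega) (hone ph_mem_affSpan)) (add_mem h1 h1)
  have hf' : (Δ g * HR β).val (pf K lam) ∈ affSpan K lam ^ (2 * m + 2) := by
    rw [hcf]
    exact Submodule.smul_mem _ _ (hle (by omega) (hone pf_mem_affSpan))
  have hpow : pf K lam ^ (2 * m + 3) ∈ affSpan K lam ^ (2 * m + 3) :=
    Submodule.pow_mem_pow _ pf_mem_affSpan _
  have he' : (Δ g * HR β).val (pe K lam) - (-(β * g.leadingCoeff ^ 2)) • pf K lam ^ (2 * m + 3) ∈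
      affSpan K lam ^ (2 * m + 2) := by
    have h1 := hmul (hmul (hone pf_mem_affSpan) (add_mem hg hfm)) (aeval_pf_sub_mem hd)
    have h2 : (Δ g * HR β).val (pe K lam) - (-(β * g.leadingCoeff ^ 2)) • pf K lam ^ (2 * m + 3) =
        (β : K) • (pe K lam - aeval (pf K lam) g * ph K lam -
          pf K lam * (aeval (pf K lam) g + g.leadingCoeff • pf K lam ^ (m + 1)) *
          (aeval (pf K lam) g - g.leadingCoeff • pf K lam ^ (m + 1))) := by
      rw [he]
      simp only [PQ.smul_eq, map_neg, map_mul, map_pow]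
      ring
    rw [h2]
    exact Submodule.smul_mem _ _ (sub_mem (sub_mem (hle (by omega) (hone pe_mem_affSpan))
      (hle (by omega) (hmul hg (hone ph_mem_affSpan)))) (hle (by omega) h1))
  have hsucc : affSpan K lam ^ (2 * m + 2) ≤ affSpan K lam ^ (2 * m + 3) :=
    affSpan_pow_mono (by omega)
  have hc0 : -((β : K) * g.leadingCoeff ^ 2) ≠ 0 := by
    refine neg_ne_zero.2 (mul_ne_zero β.ne_zero (pow_ne_zero _ (leadingCoeff_ne_zero.2 ?_)))
    rintro rfl
    simp at hd
  have h1 := hF.map ((Δ g * HR β).val : PQ K lam →ₐ[K] PQ K lam)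
    (map_affSpan_le (one_mem_affSpan_pow _) (by
      have h2 := add_mem (hsucc he') (Submodule.smul_mem _ (-(β * g.leadingCoeff ^ 2)) hpow)
      rwa [sub_add_cancel] at h2) (hsucc hh') (hsucc hf'))
    (map_borelSpan_le (one_mem_affSpan_pow _) hh' hf') hc0 hpow he' hsucc
  obtain ⟨d, hd0, h1⟩ := h1
  refine ⟨(2 * m + 3) * N + (2 * m + 2), by omega, d, hd0, ?_⟩
  rw [← pow_mul, ← pow_mul, ← pow_add] at h1
  rw [mul_one, show (2 * m + 3) * N + (2 * m + 2) + 1 = (2 * m + 3) * (N + 1) by ring]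
  exact h1

theorem exists_isLead_prod (l : List (Bool × ↥(PAut B)))
    (hA : ∀ a, (true, a) ∈ l → a ∈ Asub B ∧ a ∉ Tsub B Δ HR)
    (hT : ∀ t, (false, t) ∈ l → t ∈ Tsub B Δ HR ∧ t ∉ Asub B)
    (hl : l.IsChain fun x y => x.1 ≠ y.1) :
    ((∀ x ∈ l.head?, x.1 = false) →
      ∃ F ∈ affSpan K lam, ∃ N, (l ≠ [] → 1 ≤ N) ∧ IsLeadF N ((l.map Prod.snd).prod.val F)) ∧
    ((∀ x ∈ l.head?, x.1 = true) →
      ∃ F ∈ affSpan K lam, ∃ N, IsLeadE N ((l.map Prod.snd).prod.val F)) := by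
  induction l with
  | nil =>
    exact ⟨fun _ => ⟨_, pf_mem_affSpan, 0, fun h => absurd rfl h, isLeadF_pf⟩,
      fun _ => ⟨_, pe_mem_affSpan, 0, isLeadE_pe⟩⟩
  | cons x l ih =>
    obtain ⟨i, a⟩ := x
    rw [List.isChain_cons] at hl
    obtain ⟨ihF, ihE⟩ := ih (fun a h => hA a (List.mem_cons_of_mem _ h))
      (fun a h => hT a (List.mem_cons_of_mem _ h)) hl.2
    constructor
    · intro h
      obtain rfl : i = false := h (i, a) rfl
      obtain ⟨F, hF, N, hN⟩ := ihE fun y hy => by simpa using hl.1 y hy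
      obtain ⟨haT, haA⟩ := hT a List.mem_cons_self
      obtain ⟨M, hM, h1⟩ := exists_isLeadF_map hΔ hHR haT haA hN
      exact ⟨F, hF, M, fun _ => hM, h1⟩
    · intro h
      obtain rfl : i = true := h (i, a) rfl
      obtain ⟨F, hF, N, -, hN⟩ := ihF fun y hy => by simpa using hl.1 y hy
      obtain ⟨haA, haT⟩ := hA a List.mem_cons_self
      exact ⟨F, hF, N, isLeadE_map hΔ hHR haA haT hN⟩

theorem prod_notMem (l : List (Bool × ↥(PAut B)))
    (hA : ∀ a, (true, a) ∈ l → a ∈ Asub B ∧ a ∉ Tsub B Δ HR)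
    (hT : ∀ t, (false, t) ∈ l → t ∈ Tsub B Δ HR ∧ t ∉ Asub B)
    (hl : l.IsChain fun x y => x.1 ≠ y.1) (hne : l ≠ []) :
    (l.map Prod.snd).prod ∉ Asub B ⊓ Tsub B Δ HR := by
  have key : ∀ l : List (Bool × ↥(PAut B)),
      (∀ a, (true, a) ∈ l → a ∈ Asub B ∧ a ∉ Tsub B Δ HR) →
      (∀ t, (false, t) ∈ l → t ∈ Tsub B Δ HR ∧ t ∉ Asub B) →
      l.IsChain (fun x y => x.1 ≠ y.1) → l ≠ [] → (∀ x ∈ l.head?, x.1 = false) →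
      (l.map Prod.snd).prod ∉ Asub B := by
    intro l hA hT hl hne hhead hmem
    obtain ⟨F, hF, N, hN, h⟩ := (exists_isLead_prod hΔ hHR l hA hT hl).1 hhead
    exact h.notMem_affSpan (hN hne) (map_affSpan_of_mem_Asub hmem hF)
  rcases l with _ | ⟨⟨i, a⟩, l⟩
  · exact absurd rfl hne
  rintro ⟨hmA, hmT⟩
  cases i
  · exact key _ hA hT hl hne (by simp) hmA
  · rw [List.map_cons, List.prod_cons] at hmA hmT
    obtain ⟨haA, haT⟩ := hA a List.mem_cons_self
    rw [List.isChain_cons] at hl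
    rcases eq_or_ne l [] with rfl | hne'
    · exact haT (by simpa using hmT)
    · exact key l (fun a h => hA a (List.mem_cons_of_mem _ h))
        (fun a h => hT a (List.mem_cons_of_mem _ h)) hl.2 hne'
        (fun y hy => by simpa using hl.1 y hy) (((Asub B).mul_mem_cancel_left haA).1 hmA)

end pingpong

end

open Monoid.PushoutI in
theorem exists_prod_normalWord_eq {ι : Type*} {G : ι → Type*} {H : Type*} [∀ i, Group (G i)]
    [Group H] {φ : ∀ i, H →* G i} (d : NormalWord.Transversal φ) (x : Monoid.PushoutI φ) :
    ∃ w : NormalWord d, w.prod = x := by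
  classical
  exact NormalWord.equiv.symm.surjective x

open Monoid.PushoutI in
theorem lift_prod_normalWord {ι : Type*} {G : ι → Type*} {H M : Type*} [∀ i, Group (G i)]
    [Group H] [Monoid M] {φ : ∀ i, H →* G i} {d : NormalWord.Transversal φ} (f : ∀ i, G i →* M)
    (k : H →* M) (hf : ∀ i, (f i).comp (φ i) = k) (w : NormalWord d) :
    lift f k hf w.prod = k w.head * (w.toList.map fun l => f l.1 l.2).prod := by
  rw [NormalWord.prod, map_mul, lift_base, Monoid.CoprodI.Word.prod, map_list_prod, map_list_prod,
    List.map_map, List.map_map]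
  congr 2

/-- A letter of a normal word is not in the image of the base group. -/
theorem notMem_range_of_mem_normalWord {ι : Type*} {G : ι → Type*} {H : Type*} [∀ i, Group (G i)]
    [Group H] {φ : ∀ i, H →* G i} {d : Monoid.PushoutI.NormalWord.Transversal φ}
    (w : Monoid.PushoutI.NormalWord d) {i : ι} {g : G i} (hg : ⟨i, g⟩ ∈ w.toList) :
    g ∉ (φ i).range := by
  intro h
  have h1 := (d.compl i).1 (a₁ := (⟨g, h⟩, ⟨1, d.one_mem i⟩))
    (a₂ := (⟨1, one_mem _⟩, ⟨g, w.normalized i g hg⟩)) (by simp)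
  exact w.ne_one _ hg (by simpa using congrArg (fun p => (p.1 : G i)) h1)

/-- A homomorphism from an amalgamated product is injective as soon as it is so on the base group
and sends no nonempty reduced word into the image of the base group. -/
theorem lift_injective_of_notMem_range {ι : Type*} {G : ι → Type*} {H M : Type*}
    [∀ i, Group (G i)] [Group H] [Group M] {φ : ∀ i, H →* G i} {f : ∀ i, G i →* M} {k : H →* M}
    (hφ : ∀ i, Function.Injective (φ i)) (hk : Function.Injective k)
    (hf : ∀ i, (f i).comp (φ i) = k)
    (h : ∀ l : List (Σ i, G i), l ≠ [] → l.IsChain (fun x y => x.1 ≠ y.1) →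
      (∀ x ∈ l, x.2 ∉ (φ x.1).range) → (l.map fun x => f x.1 x.2).prod ∉ k.range) :
    Function.Injective (Monoid.PushoutI.lift f k hf) := by
  rw [injective_iff_map_eq_one]
  obtain ⟨d⟩ := Monoid.PushoutI.NormalWord.transversal_nonempty φ hφ
  intro x hx
  obtain ⟨w, rfl⟩ := exists_prod_normalWord_eq d x
  rw [lift_prod_normalWord] at hx
  have hw : w.toList = [] := by
    by_contra hne
    refine h w.toList hne w.chain_ne (fun x hx => notMem_range_of_mem_normalWord w hx) ?_
    rw [← inv_eq_of_mul_eq_one_right hx]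
    exact inv_mem ⟨_, rfl⟩
  rw [hw, List.map_nil, List.prod_nil, mul_one] at hx
  have hhead : w.head = 1 := hk (hx.trans (map_one k).symm)
  rw [show w = Monoid.PushoutI.NormalWord.empty from Monoid.PushoutI.NormalWord.ext hhead hw,
    Monoid.PushoutI.NormalWord.prod_empty]

section amalgam

variable {B : PoissonBr K lam} {Δ : Polynomial K → ↥(PAut B)} {HR : Kˣ → ↥(PAut B)}

theorem amalgIncl_injective (i : Bool) : Function.Injective (amalgIncl B Δ HR i) := by
  cases i
  · exact Subgroup.inclusion_injective (inf_le_right : Asub B ⊓ Tsub B Δ HR ≤ Tsub B Δ HR)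
  · exact Subgroup.inclusion_injective (inf_le_left : Asub B ⊓ Tsub B Δ HR ≤ Asub B)

theorem amalgToAut_true_notMem {g : amalgFam B Δ HR true} (hg : g ∉ (amalgIncl B Δ HR true).range) :
    amalgToAut B Δ HR true g ∈ Asub B ∧ amalgToAut B Δ HR true g ∉ Tsub B Δ HR :=
  ⟨g.2, fun h => hg ⟨⟨g.1, g.2, h⟩, rfl⟩⟩

theorem amalgToAut_false_notMem {g : amalgFam B Δ HR false}
    (hg : g ∉ (amalgIncl B Δ HR false).range) :
    amalgToAut B Δ HR false g ∈ Tsub B Δ HR ∧ amalgToAut B Δ HR false g ∉ Asub B :=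
  ⟨g.2, fun h => hg ⟨⟨g.1, h, g.2⟩, rfl⟩⟩

variable (hΔ : ∀ g, IsDelta B g (Δ g)) (hHR : ∀ β, IsHRot B β (HR β))

include hΔ hHR

theorem lift_amalgToAut_injective
    (h : ∀ i, (amalgToAut B Δ HR i).comp (amalgIncl B Δ HR i) = (Asub B ⊓ Tsub B Δ HR).subtype) :
    Function.Injective (Monoid.PushoutI.lift (amalgToAut B Δ HR)
      (Asub B ⊓ Tsub B Δ HR).subtype h) := by
  refine lift_injective_of_notMem_range amalgIncl_injective (Subgroup.subtype_injective _) h ?_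
  intro l hne hl hmem
  rw [Subgroup.range_subtype]
  have key : (l.map fun x => amalgToAut B Δ HR x.1 x.2) =
      (l.map fun x => (x.1, amalgToAut B Δ HR x.1 x.2)).map Prod.snd := by
    rw [List.map_map]
    rfl
  rw [key]
  refine prod_notMem hΔ hHR _ ?_ ?_ ?_ ?_
  · rintro a ha
    obtain ⟨⟨j, g⟩, hg, he⟩ := List.mem_map.1 ha
    obtain ⟨h1, h2⟩ := Prod.mk.inj he
    subst h1 h2
    exact amalgToAut_true_notMem (hmem _ hg)
  · rintro a ha
    obtain ⟨⟨j, g⟩, hg, he⟩ := List.mem_map.1 ha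
    obtain ⟨h1, h2⟩ := Prod.mk.inj he
    subst h1 h2
    exact amalgToAut_false_notMem (hmem _ hg)
  · rw [List.isChain_map]
    exact hl
  · simpa using hne

theorem lift_amalgToAut_surjective
    (h : ∀ i, (amalgToAut B Δ HR i).comp (amalgIncl B Δ HR i) = (Asub B ⊓ Tsub B Δ HR).subtype) :
    Function.Surjective (Monoid.PushoutI.lift (amalgToAut B Δ HR)
      (Asub B ⊓ Tsub B Δ HR).subtype h) := by
  rw [← MonoidHom.range_eq_top, ← top_le_iff, ← Asub_sup_Tsub hΔ hHR, sup_le_iff]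
  constructor
  · intro a ha
    exact ⟨Monoid.PushoutI.of (G := amalgFam B Δ HR) true ⟨a, ha⟩, Monoid.PushoutI.lift_of _ _ _ _⟩
  · intro a ha
    exact ⟨Monoid.PushoutI.of (G := amalgFam B Δ HR) false ⟨a, ha⟩, Monoid.PushoutI.lift_of _ _ _ _⟩

end amalgam

/-- `C = A ∩ T` (`C` being the subgroup of linear triangular automorphisms)
and the canonical homomorphism from the amalgamated free product (pushout) `A *_C T` to
`Aut(P_λ)` induced by the inclusions of `A` and `T` is a group isomorphism. -/
theorem aut_Plam_amalgamated_free_product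
    (Δ : Polynomial K → ↥(PAut B)) (hΔ : ∀ g, IsDelta B g (Δ g))
    (HR : Kˣ → ↥(PAut B)) (hHR : ∀ β, IsHRot B β (HR β)) :
    ((Asub B ⊓ Tsub B Δ HR : Subgroup ↥(PAut B)) : Set ↥(PAut B)) = CsetLT B ∧
    Function.Bijective
      (Monoid.PushoutI.lift (φ := amalgIncl B Δ HR) (amalgToAut B Δ HR)
        (Asub B ⊓ Tsub B Δ HR).subtype
        (by intro i; cases i <;> rfl)) := by
  exact ⟨Asub_inf_Tsub hΔ hHR, lift_amalgToAut_injective hΔ hHR _,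
    lift_amalgToAut_surjective hΔ hHR _⟩
end
end

section
/- J′ is a normal subgroup of T′, T′ = J′·H, and J′ ∩ H = {id}; consequently T′ is the internal semidirect product J′ ⋊ H. -/
noncomputable section

open scoped Pointwise

variable (K : Type*) [Field K] [IsAlgClosed K] [CharZero K] (lam : K)

/-- The standard basis element `E` of `sl₂(K)`. -/
def slE : ↥(LieAlgebra.SpecialLinear.sl (Fin 2) K) :=
  ⟨!![0, 1; 0, 0], LinearMap.mem_ker.2 (by simp [Matrix.trace_fin_two])⟩

/-- The standard basis element `H` of `sl₂(K)`. -/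
def slH : ↥(LieAlgebra.SpecialLinear.sl (Fin 2) K) :=
  ⟨!![1, 0; 0, -1], LinearMap.mem_ker.2 (by simp [Matrix.trace_fin_two])⟩

/-- The standard basis element `F` of `sl₂(K)`. -/
def slF : ↥(LieAlgebra.SpecialLinear.sl (Fin 2) K) :=
  ⟨!![0, 0; 1, 0], LinearMap.mem_ker.2 (by simp [Matrix.trace_fin_two])⟩

/-- The universal enveloping algebra `U(sl₂(K))`. -/
abbrev USl2 : Type _ :=
  UniversalEnvelopingAlgebra K ↥(LieAlgebra.SpecialLinear.sl (Fin 2) K)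

/-- The Casimir element `C_U = 2EF + 2FE + H²` of `U(sl₂(K))`. -/
def casimirU : USl2 K :=
  2 * UniversalEnvelopingAlgebra.ι K (slE K) * UniversalEnvelopingAlgebra.ι K (slF K) +
    2 * UniversalEnvelopingAlgebra.ι K (slF K) * UniversalEnvelopingAlgebra.ι K (slE K) +
    UniversalEnvelopingAlgebra.ι K (slH K) ^ 2

/-- `U_λ`: the quotient of `U(sl₂(K))` by the two-sided ideal generated by `C_U − λ`. -/
abbrev ULam : Type _ :=
  RingQuot (fun a b : USl2 K => a = casimirU K ∧ b = algebraMap K (USl2 K) lam)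

/-- `e`, the image of `E` in `U_λ`. -/
def ue : ULam K lam :=
  RingQuot.mkAlgHom K _ (UniversalEnvelopingAlgebra.ι K (slE K))

/-- `h`, the image of `H` in `U_λ`. -/
def uh : ULam K lam :=
  RingQuot.mkAlgHom K _ (UniversalEnvelopingAlgebra.ι K (slH K))

/-- `f`, the image of `F` in `U_λ`. -/
def uf : ULam K lam :=
  RingQuot.mkAlgHom K _ (UniversalEnvelopingAlgebra.ι K (slF K))

variable {K lam}

/-- `D` is the automorphism `δ_g` of `U_λ`:
`e ↦ e − g(f)h − f·g(f)² + f·g′(f)`, `h ↦ h + 2f·g(f)`, `f ↦ f`. -/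
def IsDeltaU (g : Polynomial K) (D : ULam K lam ≃ₐ[K] ULam K lam) : Prop :=
  D (ue K lam) =
      ue K lam - Polynomial.aeval (uf K lam) g * uh K lam -
        uf K lam * Polynomial.aeval (uf K lam) g ^ 2 +
        uf K lam * Polynomial.aeval (uf K lam) (Polynomial.derivative g) ∧
  D (uh K lam) = uh K lam + 2 * (uf K lam * Polynomial.aeval (uf K lam) g) ∧
  D (uf K lam) = uf K lam

/-- `D` is the hyperbolic rotation `H_β` of `U_λ`: `e ↦ βe`, `h ↦ h`, `f ↦ β⁻¹f`. -/
def IsHRotU (β : Kˣ) (D : ULam K lam ≃ₐ[K] ULam K lam) : Prop :=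
  D (ue K lam) = (β : K) • ue K lam ∧
  D (uh K lam) = uh K lam ∧
  D (uf K lam) = (β : K)⁻¹ • uf K lam

section

variable {k : Type*} [Field k] {c : k}

attribute [local instance] LieRing.ofAssociativeRing

theorem sl_two_eq (x : ↥(LieAlgebra.SpecialLinear.sl (Fin 2) k)) :
    x = x.1 0 1 • slE k + x.1 0 0 • slH k + x.1 1 0 • slF k := by
  obtain ⟨x, hx⟩ := x
  have htr : x 0 0 + x 1 1 = 0 := by
    have := LinearMap.mem_ker.1 hx
    simpa [Matrix.trace_fin_two] using this
  have h11 : x 1 1 = -x 0 0 := by linear_combination htr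
  apply Subtype.ext
  ext i j
  fin_cases i <;> fin_cases j <;> simp [slE, slH, slF, h11]

theorem lie_slE_slF : ⁅slE k, slF k⁆ = slH k := by
  apply Subtype.ext
  rw [LieSubalgebra.coe_bracket, Ring.lie_def]
  ext i j
  fin_cases i <;> fin_cases j <;> simp [slE, slH, slF]

theorem ue_mul_uf_sub : ue k c * uf k c - uf k c * ue k c = uh k c := by
  have h := (UniversalEnvelopingAlgebra.ι k).map_lie (slE k) (slF k)
  rw [lie_slE_slF, Ring.lie_def] at h
  simp only [ue, uf, uh, h, map_sub, map_mul]

/-- Automorphisms of `U_λ` agreeing on the generators `e`, `h`, `f` are equal. -/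
theorem ULam.algEquiv_ext {D₁ D₂ : ULam k c ≃ₐ[k] ULam k c}
    (he : D₁ (ue k c) = D₂ (ue k c)) (hh : D₁ (uh k c) = D₂ (uh k c))
    (hf : D₁ (uf k c) = D₂ (uf k c)) : D₁ = D₂ := by
  have key : (D₁ : ULam k c →ₐ[k] ULam k c) = D₂ := by
    apply RingQuot.ringQuot_ext'
    apply UniversalEnvelopingAlgebra.hom_ext
    refine LieHom.ext fun x => ?_
    rw [sl_two_eq x]
    simp only [ue, uh, uf] at he hh hf
    simp [he, hh, hf, -UniversalEnvelopingAlgebra.ι_apply]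
  exact AlgEquiv.ext fun x => DFunLike.congr_fun key x

theorem map_aeval_of_fixed {D : ULam k c ≃ₐ[k] ULam k c} (hf : D (uf k c) = uf k c)
    (p : Polynomial k) :
    D (Polynomial.aeval (uf k c) p) = Polynomial.aeval (uf k c) p := by
  rw [← Polynomial.aeval_algHom_apply, hf]

theorem IsDeltaU.unique {g : Polynomial k} {D₁ D₂ : ULam k c ≃ₐ[k] ULam k c}
    (h₁ : IsDeltaU g D₁) (h₂ : IsDeltaU g D₂) : D₁ = D₂ :=
  ULam.algEquiv_ext (h₁.1.trans h₂.1.symm) (h₁.2.1.trans h₂.2.1.symm)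
    (h₁.2.2.trans h₂.2.2.symm)

theorem IsHRotU.unique {β : kˣ} {D₁ D₂ : ULam k c ≃ₐ[k] ULam k c}
    (h₁ : IsHRotU β D₁) (h₂ : IsHRotU β D₂) : D₁ = D₂ :=
  ULam.algEquiv_ext (h₁.1.trans h₂.1.symm) (h₁.2.1.trans h₂.2.1.symm)
    (h₁.2.2.trans h₂.2.2.symm)

theorem isDeltaU_zero : IsDeltaU 0 (1 : ULam k c ≃ₐ[k] ULam k c) := by
  simp [IsDeltaU]

theorem isHRotU_one : IsHRotU 1 (1 : ULam k c ≃ₐ[k] ULam k c) := by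
  simp [IsHRotU]

theorem IsDeltaU.mul {g p : Polynomial k} {D₁ D₂ : ULam k c ≃ₐ[k] ULam k c}
    (h₁ : IsDeltaU g D₁) (h₂ : IsDeltaU p D₂) : IsDeltaU (g + p) (D₁ * D₂) := by
  obtain ⟨he₁, hh₁, hf₁⟩ := h₁
  obtain ⟨he₂, hh₂, hf₂⟩ := h₂
  have hcomm (r s : Polynomial k) :
      Polynomial.aeval (uf k c) r * Polynomial.aeval (uf k c) s =
        Polynomial.aeval (uf k c) s * Polynomial.aeval (uf k c) r := by
    rw [← map_mul, mul_comm, map_mul]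
  have hgp := hcomm g p
  have hgf := hcomm p Polynomial.X
  rw [Polynomial.aeval_X] at hgf
  refine ⟨?_, ?_, ?_⟩
  · simp only [AlgEquiv.mul_apply, he₂, map_add, map_sub, map_mul, map_pow,
      map_aeval_of_fixed hf₁, he₁, hh₁, hf₁]
    have hcross : Polynomial.aeval (uf k c) p *
        (2 * (uf k c * Polynomial.aeval (uf k c) g)) =
        uf k c * Polynomial.aeval (uf k c) g * Polynomial.aeval (uf k c) p +
        uf k c * Polynomial.aeval (uf k c) p * Polynomial.aeval (uf k c) g := by
      rw [two_mul, mul_add, ← mul_assoc, hgf, mul_assoc, mul_assoc, hgp]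
    rw [mul_add (Polynomial.aeval (uf k c) p), hcross]
    noncomm_ring
  · simp only [AlgEquiv.mul_apply, hh₂, map_add, map_mul, map_ofNat,
      map_aeval_of_fixed hf₁, hh₁, hf₁]
    noncomm_ring
  · simp only [AlgEquiv.mul_apply, hf₂, hf₁]

theorem IsHRotU.mul {β γ : kˣ} {D₁ D₂ : ULam k c ≃ₐ[k] ULam k c}
    (h₁ : IsHRotU β D₁) (h₂ : IsHRotU γ D₂) : IsHRotU (β * γ) (D₁ * D₂) := by
  obtain ⟨he₁, hh₁, hf₁⟩ := h₁
  obtain ⟨he₂, hh₂, hf₂⟩ := h₂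
  refine ⟨?_, ?_, ?_⟩
  · simp [he₂, he₁, smul_smul, mul_comm]
  · simp [hh₂, hh₁]
  · simp [hf₂, hf₁, smul_smul, mul_comm]

/-- Rotating `δ_g` by `H_β` gives `δ_p` with `p(x) = β⁻¹ g(β⁻¹ x)`. -/
theorem IsDeltaU.hRot_mul_eq {g : Polynomial k} {β : kˣ} {D R D' : ULam k c ≃ₐ[k] ULam k c}
    (hD : IsDeltaU g D) (hR : IsHRotU β R)
    (hD' : IsDeltaU (Polynomial.C (β : k)⁻¹ *
      g.comp (Polynomial.C (β : k)⁻¹ * Polynomial.X)) D') :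
    R * D = D' * R := by
  obtain ⟨he, hh, hf⟩ := hD
  obtain ⟨re, rh, rf⟩ := hR
  obtain ⟨he', hh', hf'⟩ := hD'
  have hmap (p : Polynomial k) : R (Polynomial.aeval (uf k c) p) =
      Polynomial.aeval ((β : k)⁻¹ • uf k c) p := by
    rw [← Polynomial.aeval_algHom_apply, rf]
  have hcomp (p : Polynomial k) : Polynomial.aeval (uf k c)
      (p.comp (Polynomial.C (β : k)⁻¹ * Polynomial.X)) =
      Polynomial.aeval ((β : k)⁻¹ • uf k c) p := by
    rw [Polynomial.aeval_comp, map_mul, Polynomial.aeval_C, Polynomial.aeval_X,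
      Algebra.smul_def]
  have hβ : (β : k) ≠ 0 := β.ne_zero
  apply ULam.algEquiv_ext
  · simp only [AlgEquiv.mul_apply, he, re, map_add, map_sub, map_mul, map_pow, hmap, rh, rf,
      map_smul, he', hcomp, Polynomial.derivative_mul, Polynomial.derivative_C,
      Polynomial.derivative_comp, Polynomial.derivative_X, Polynomial.aeval_C,
      zero_mul, zero_add, mul_one, ← Algebra.smul_def]
    simp only [smul_add, smul_sub, smul_mul_assoc, mul_smul_comm, smul_smul, pow_two,
      mul_inv_cancel₀ hβ, mul_inv_cancel_left₀ hβ, one_smul]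
  · simp only [AlgEquiv.mul_apply, hh, rh, map_add, map_mul, map_ofNat, hmap, rf, hh', hcomp,
      Polynomial.aeval_C, ← Algebra.smul_def, smul_mul_assoc, mul_smul_comm]
  · simp only [AlgEquiv.mul_apply, hf', hf, rf, map_smul]

/-- An automorphism that is both some `δ_g` and some `H_β` is the identity. -/
theorem IsDeltaU.eq_one_of_isHRotU {g : Polynomial k} {β : kˣ} {D : ULam k c ≃ₐ[k] ULam k c}
    (hD : IsDeltaU g D) (hR : IsHRotU β D) : D = 1 := by
  by_cases hf : uf k c = 0
  · have hh : uh k c = 0 := by rw [← ue_mul_uf_sub, hf, mul_zero, zero_mul, sub_zero]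
    apply ULam.algEquiv_ext
    · rw [hD.1, hf, hh]
      simp
    · exact hR.2.1
    · exact hD.2.2
  · have h : ((β : k)⁻¹ - 1) • uf k c = 0 := by
      rw [sub_smul, one_smul, ← hR.2.2, hD.2.2, sub_self]
    have hβ : β = 1 := by
      have := (smul_eq_zero.1 h).resolve_right hf
      exact Units.ext (inv_eq_one.1 (sub_eq_zero.1 this))
    subst hβ
    exact hR.unique isHRotU_one

end

/-- `J′` is a normal subgroup of `T′`, `T′ = J′·H`, and `J′ ∩ H = {id}`;
hence `T′` is the internal semidirect product `J′ ⋊ H`. Here `J′ = {δ_g : g ∈ K[x]}`,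
`H = {H_β : β ∈ Kˣ}` and `T′ = ⟨J′, H⟩ ⊆ Aut(U_λ)`. -/
theorem triangularU_semidirect
    (δ : Polynomial K → (ULam K lam ≃ₐ[K] ULam K lam)) (hδ : ∀ g, IsDeltaU g (δ g))
    (HR : Kˣ → (ULam K lam ≃ₐ[K] ULam K lam)) (hHR : ∀ β, IsHRotU β (HR β)) :
    (((Subgroup.closure (Set.range δ) : Subgroup (ULam K lam ≃ₐ[K] ULam K lam)) :
        Set (ULam K lam ≃ₐ[K] ULam K lam)) = Set.range δ) ∧
    (((Subgroup.closure (Set.range HR) : Subgroup (ULam K lam ≃ₐ[K] ULam K lam)) :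
        Set (ULam K lam ≃ₐ[K] ULam K lam)) = Set.range HR) ∧
    (∀ t ∈ Subgroup.closure (Set.range δ ∪ Set.range HR),
      ∀ j ∈ Subgroup.closure (Set.range δ),
        t * j * t⁻¹ ∈ Subgroup.closure (Set.range δ)) ∧
    (∀ t ∈ Subgroup.closure (Set.range δ ∪ Set.range HR),
      ∃ j ∈ Subgroup.closure (Set.range δ),
        ∃ k ∈ Subgroup.closure (Set.range HR), t = j * k) ∧
    (Subgroup.closure (Set.range δ) ⊓ Subgroup.closure (Set.range HR) = ⊥) := by
  have hδ1 : δ 0 = 1 := (hδ 0).unique isDeltaU_zero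
  have hH1 : HR 1 = 1 := (hHR 1).unique isHRotU_one
  have hδmul (g k) : δ g * δ k = δ (g + k) := ((hδ g).mul (hδ k)).unique (hδ _)
  have hHmul (β γ) : HR β * HR γ = HR (β * γ) := ((hHR β).mul (hHR γ)).unique (hHR _)
  let φ : Multiplicative (Polynomial K) →* (ULam K lam ≃ₐ[K] ULam K lam) :=
    { toFun := fun g => δ g.toAdd, map_one' := hδ1, map_mul' := fun g k => (hδmul _ _).symm }
  let ψ : Kˣ →* (ULam K lam ≃ₐ[K] ULam K lam) :=
    { toFun := HR, map_one' := hH1, map_mul' := fun β γ => (hHmul β γ).symm }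
  have hJ : Subgroup.closure (Set.range δ) = φ.range := by
    rw [← Subgroup.closure_eq φ.range]
    rfl
  have hH : Subgroup.closure (Set.range HR) = ψ.range := by
    rw [← Subgroup.closure_eq ψ.range]
    rfl
  have hnormal : ∀ t ∈ Subgroup.closure (Set.range δ ∪ Set.range HR),
      t ∈ Subgroup.normalizer (φ.range : Set (ULam K lam ≃ₐ[K] ULam K lam)) := by
    have hconj (β : Kˣ) (x) (hx : x ∈ φ.range) : HR β * x * (HR β)⁻¹ ∈ φ.range := by
      obtain ⟨g, rfl⟩ := hx
      refine ⟨Multiplicative.ofAdd (Polynomial.C (β : K)⁻¹ *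
        g.toAdd.comp (Polynomial.C (β : K)⁻¹ * Polynomial.X)), ?_⟩
      rw [eq_mul_inv_iff_mul_eq]
      exact ((hδ g.toAdd).hRot_mul_eq (hHR β) (hδ _)).symm
    intro t ht
    refine (Subgroup.closure_le _).2 ?_ ht
    rintro _ (⟨g, rfl⟩ | ⟨β, rfl⟩)
    · exact Subgroup.le_normalizer ⟨Multiplicative.ofAdd g, rfl⟩
    · refine Subgroup.mem_normalizer_iff.2 fun x => ⟨hconj β x, fun hx => ?_⟩
      have := hconj β⁻¹ _ hx
      rw [show HR β⁻¹ = (HR β)⁻¹ from map_inv ψ β] at this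
      simpa [mul_assoc] using this
  rw [hJ, hH]
  refine ⟨rfl, rfl, fun t ht j hj => ((Subgroup.mem_normalizer_iff.1 (hnormal t ht)) j).1 hj,
    fun t ht => ?_, ?_⟩
  · have hψ : ψ.range ≤ Subgroup.normalizer (φ.range : Set (ULam K lam ≃ₐ[K] ULam K lam)) := by
      rintro _ ⟨β, rfl⟩
      exact hnormal _ (Subgroup.subset_closure (Or.inr ⟨β, rfl⟩))
    rw [Subgroup.closure_union, hJ, hH, ← SetLike.mem_coe,
      Subgroup.coe_mul_of_right_le_normalizer_left _ _ hψ] at ht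
    obtain ⟨j, hj, k, hk, rfl⟩ := Set.mem_mul.1 ht
    exact ⟨j, hj, k, hk, rfl⟩
  · rw [eq_bot_iff]
    rintro x ⟨⟨g, rfl⟩, ⟨β, hβ⟩⟩
    exact Subgroup.mem_bot.2
      ((hδ g.toAdd).eq_one_of_isHRotU (β := β) (show IsHRotU β (φ g) from hβ ▸ hHR β))
end
end

section
/- Every element of T′ can be written uniquely in the form e ↦ αe − αg(f)h − αf·g(f)² + αf·g′(f), h ↦ h + 2f·g(f), f ↦ α⁻¹f, for some g ∈ K[x] and α ∈ Kˣ. -/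
noncomputable section

open scoped Pointwise

variable (K : Type*) [Field K] [IsAlgClosed K] [CharZero K] (lam : K)

variable {K lam}

section VermaModule

open Polynomial

attribute [local instance] LieRing.ofAssociativeRing

/-- Multiplication by `X`, the action of `F` on the Verma module `K[X]`. -/
def vermaF : Module.End K K[X] := LinearMap.mulLeft K X

/-- The action `m - 2X∂` of `H` on the Verma module `K[X]` of highest weight `m`. -/
def vermaH (m : K) : Module.End K K[X] :=
  m • 1 - (2 : K) • (LinearMap.mulLeft K X * derivative)

/-- The action `m∂ - X∂²` of `E` on the Verma module `K[X]` of highest weight `m`. -/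
def vermaE (m : K) : Module.End K K[X] :=
  m • derivative - LinearMap.mulLeft K X * (derivative * derivative)

omit [IsAlgClosed K] [CharZero K] in
theorem vermaF_apply (p : K[X]) : vermaF p = X * p := rfl

omit [IsAlgClosed K] [CharZero K] in
theorem vermaH_apply (m : K) (p : K[X]) :
    vermaH m p = C m * p - 2 * (X * derivative p) := by
  simp [vermaH, two_smul, two_mul, smul_eq_C_mul]

omit [IsAlgClosed K] [CharZero K] in
theorem vermaE_apply (m : K) (p : K[X]) :
    vermaE m p = C m * derivative p - X * derivative (derivative p) := by
  simp [vermaE, smul_eq_C_mul]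

omit [IsAlgClosed K] [CharZero K] in
theorem vermaE_mul_vermaF_sub (m : K) :
    vermaE m * vermaF - vermaF * vermaE m = vermaH m := by
  refine LinearMap.ext fun p => ?_
  simp [vermaE_apply, vermaF_apply, vermaH_apply]
  ring

omit [IsAlgClosed K] [CharZero K] in
theorem vermaH_mul_vermaE_sub (m : K) :
    vermaH m * vermaE m - vermaE m * vermaH m = (2 : K) • vermaE m := by
  refine LinearMap.ext fun p => ?_
  simp [vermaE_apply, vermaH_apply, smul_eq_C_mul, map_ofNat]
  ring

omit [IsAlgClosed K] [CharZero K] in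
theorem vermaH_mul_vermaF_sub (m : K) :
    vermaH m * vermaF - vermaF * vermaH m = -(2 : K) • vermaF := by
  refine LinearMap.ext fun p => ?_
  simp [vermaF_apply, vermaH_apply, smul_eq_C_mul, map_ofNat]
  ring

omit [IsAlgClosed K] [CharZero K] in
theorem verma_casimir (m : K) :
    2 * vermaE m * vermaF + 2 * vermaF * vermaE m + vermaH m ^ 2 =
      algebraMap K (Module.End K K[X]) (m ^ 2 + 2 * m) := by
  refine LinearMap.ext fun p => ?_
  simp [two_mul, pow_two, add_mul, vermaE_apply, vermaF_apply, vermaH_apply, smul_eq_C_mul]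
  ring

/-- The Verma module of highest weight `m` as a representation of `sl₂(K)`. -/
def vermaLie (m : K) :
    ↥(LieAlgebra.SpecialLinear.sl (Fin 2) K) →ₗ⁅K⁆ Module.End K K[X] where
  toFun A := A.1 0 1 • vermaE m + A.1 0 0 • vermaH m + A.1 1 0 • vermaF
  map_add' A B := by
    have h (i j) : (A + B).1 i j = A.1 i j + B.1 i j := rfl
    rw [h, h, h]
    module
  map_smul' c A := by
    have h (i j) : (c • A).1 i j = c * A.1 i j := rfl
    rw [h, h, h, RingHom.id_apply]
    module
  map_lie' {A B} := by
    have hA : A.1 1 1 = -A.1 0 0 := by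
      have := LinearMap.mem_ker.1 A.2
      rw [Matrix.traceLinearMap_apply, Matrix.trace_fin_two] at this
      linear_combination this
    have hB : B.1 1 1 = -B.1 0 0 := by
      have := LinearMap.mem_ker.1 B.2
      rw [Matrix.traceLinearMap_apply, Matrix.trace_fin_two] at this
      linear_combination this
    have hEF := vermaE_mul_vermaF_sub m
    have hHE := vermaH_mul_vermaE_sub m
    have hHF := vermaH_mul_vermaF_sub m
    have h (i j) : ⁅A, B⁆.1 i j = A.1 i 0 * B.1 0 j + A.1 i 1 * B.1 1 j -
        (B.1 i 0 * A.1 0 j + B.1 i 1 * A.1 1 j) := by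
      change (A.1 * B.1 - B.1 * A.1) i j = _
      simp [Matrix.mul_apply]
    rw [h, h, h, hA, hB, LieRing.of_associative_ring_bracket]
    simp only [mul_add, add_mul, smul_mul_assoc, mul_smul_comm]
    linear_combination (norm := module)
      -(A.1 0 1 * B.1 1 0 - A.1 1 0 * B.1 0 1) • hEF
        - (A.1 0 0 * B.1 0 1 - A.1 0 1 * B.1 0 0) • hHE
        - (A.1 0 0 * B.1 1 0 - A.1 1 0 * B.1 0 0) • hHF

/-- The Verma module of highest weight `m` as a representation of `U_λ`, where
`λ = m² + 2m`. -/
def vermaRep (m : K) (hm : m ^ 2 + 2 * m = lam) : ULam K lam →ₐ[K] Module.End K K[X] :=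
  RingQuot.liftAlgHom K ⟨UniversalEnvelopingAlgebra.lift K (vermaLie m), by
    rintro _ _ ⟨rfl, rfl⟩
    simpa [casimirU, vermaLie, slE, slF, slH, hm, map_ofNat] using verma_casimir m⟩

omit [IsAlgClosed K] [CharZero K] in
theorem vermaRep_uf (m : K) (hm : m ^ 2 + 2 * m = lam) :
    vermaRep m hm (uf K lam) = vermaF := by
  simp [vermaRep, uf, vermaLie, slF]

omit [IsAlgClosed K] [CharZero K] in
theorem aeval_vermaF_apply (p q : K[X]) : aeval (vermaF : Module.End K K[X]) p q = p * q := by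
  have h : (vermaF : Module.End K K[X]) = Algebra.lmul K K[X] X := rfl
  rw [h, aeval_algHom_apply, aeval_X_left_apply]
  rfl

omit [CharZero K] in
/-- The element `f` of `U_λ` is transcendental over `K`. -/
theorem aeval_uf_injective : Function.Injective (aeval (R := K) (uf K lam)) := by
  obtain ⟨m, hm⟩ : ∃ m : K, m ^ 2 + 2 * m = lam := by
    obtain ⟨z, hz⟩ := IsAlgClosed.exists_pow_nat_eq (lam + 1) (n := 2) two_pos
    exact ⟨z - 1, by linear_combination hz⟩
  intro p q hpq
  have h := congrArg (fun x => vermaRep m hm x 1) hpq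
  simpa [← aeval_algHom_apply, vermaRep_uf, aeval_vermaF_apply] using h

end VermaModule

section NormalForm

open Polynomial

/-- `t` is the triangular automorphism with parameters `g` and `α`, written with all
polynomials in `f` collected. -/
def IsTriangularU (g : K[X]) (α : Kˣ) (t : ULam K lam ≃ₐ[K] ULam K lam) : Prop :=
  t (ue K lam) = (α : K) • (ue K lam - aeval (uf K lam) g * uh K lam +
      aeval (uf K lam) (X * (derivative g - g ^ 2))) ∧
    t (uh K lam) = uh K lam + aeval (uf K lam) (2 * (X * g)) ∧
    t (uf K lam) = aeval (uf K lam) (C (α : K)⁻¹ * X)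

omit [IsAlgClosed K] [CharZero K] in
theorem isTriangularU_iff (g : K[X]) (α : Kˣ) (t : ULam K lam ≃ₐ[K] ULam K lam) :
    IsTriangularU g α t ↔
      t (ue K lam) =
          (α : K) • ue K lam -
            (α : K) • (aeval (uf K lam) g * uh K lam) -
            (α : K) • (uf K lam * aeval (uf K lam) g ^ 2) +
            (α : K) • (uf K lam * aeval (uf K lam) (derivative g)) ∧
      t (uh K lam) = uh K lam + 2 * (uf K lam * aeval (uf K lam) g) ∧
      t (uf K lam) = ((α : K))⁻¹ • uf K lam := by
  have he : (α : K) • (ue K lam - aeval (uf K lam) g * uh K lam +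
      aeval (uf K lam) (X * (derivative g - g ^ 2))) =
      (α : K) • ue K lam - (α : K) • (aeval (uf K lam) g * uh K lam) -
        (α : K) • (uf K lam * aeval (uf K lam) g ^ 2) +
        (α : K) • (uf K lam * aeval (uf K lam) (derivative g)) := by
    simp only [map_mul, map_sub, map_pow, aeval_X, mul_sub]
    module
  have hh : aeval (uf K lam) (2 * (X * g)) = 2 * (uf K lam * aeval (uf K lam) g) := by
    simp [map_ofNat]
  have hf : aeval (uf K lam) (C (α : K)⁻¹ * X) = (α : K)⁻¹ • uf K lam := by
    simp [Algebra.smul_def]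
  rw [IsTriangularU, he, hh, hf]

omit [IsAlgClosed K] [CharZero K] in
theorem IsDeltaU.isTriangularU {g : K[X]} {t : ULam K lam ≃ₐ[K] ULam K lam}
    (h : IsDeltaU g t) : IsTriangularU g 1 t := by
  rw [isTriangularU_iff]
  simpa [IsDeltaU, IsHRotU] using h

omit [IsAlgClosed K] [CharZero K] in
theorem IsHRotU.isTriangularU {β : Kˣ} {t : ULam K lam ≃ₐ[K] ULam K lam}
    (h : IsHRotU β t) : IsTriangularU 0 β t := by
  rw [isTriangularU_iff]
  simpa [IsDeltaU, IsHRotU] using h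

omit [IsAlgClosed K] [CharZero K] in
theorem IsTriangularU.map_aeval {g : K[X]} {α : Kˣ} {t : ULam K lam ≃ₐ[K] ULam K lam}
    (ht : IsTriangularU g α t) (k : K[X]) :
    t (aeval (uf K lam) k) = aeval (uf K lam) (k.comp (C (α : K)⁻¹ * X)) := by
  rw [aeval_comp, ← ht.2.2]
  exact (aeval_algHom_apply (t : ULam K lam →ₐ[K] ULam K lam) _ _).symm

omit [IsAlgClosed K] [CharZero K] in
theorem IsTriangularU.mul {g k : K[X]} {α β : Kˣ} {t s : ULam K lam ≃ₐ[K] ULam K lam}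
    (ht : IsTriangularU g α t) (hs : IsTriangularU k β s) :
    IsTriangularU (g + C (α : K)⁻¹ * k.comp (C (α : K)⁻¹ * X)) (α * β) (t * s) := by
  have hC : (C (α : K) : K[X]) * C (α : K)⁻¹ = 1 := by
    rw [← C_mul, mul_inv_cancel₀ α.ne_zero, C_1]
  refine ⟨?_, ?_, ?_⟩
  · have hcomp : derivative (k.comp (C (α : K)⁻¹ * X)) =
        C (α : K)⁻¹ * (derivative k).comp (C (α : K)⁻¹ * X) := by
      simp [derivative_comp]
    rw [AlgEquiv.mul_apply, hs.1, map_smul, map_add, map_sub, map_mul, ht.1, ht.2.1,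
      ht.map_aeval, ht.map_aeval, Units.val_mul, mul_comm (α : K), mul_smul]
    congr 1
    have hk : aeval (uf K lam) (k.comp (C (α : K)⁻¹ * X)) = (α : K) •
        aeval (uf K lam) (C (α : K)⁻¹ * k.comp (C (α : K)⁻¹ * X)) := by
      rw [← map_smul, smul_eq_C_mul, ← mul_assoc, hC, one_mul]
    have hpoly : (X * (derivative k - k ^ 2)).comp (C (α : K)⁻¹ * X) -
        k.comp (C (α : K)⁻¹ * X) * (2 * (X * g)) + C (α : K) * (X * (derivative g - g ^ 2)) =
        C (α : K) * (X * (derivative (g + C (α : K)⁻¹ * k.comp (C (α : K)⁻¹ * X)) -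
          (g + C (α : K)⁻¹ * k.comp (C (α : K)⁻¹ * X)) ^ 2)) := by
      simp only [derivative_add, derivative_C_mul, hcomp, mul_comp, sub_comp, pow_comp, X_comp]
      generalize (derivative k).comp (C (α : K)⁻¹ * X) = k'
      generalize k.comp (C (α : K)⁻¹ * X) = k₀
      linear_combination (-(X * C (α : K)⁻¹ * (k' - k₀ ^ 2)) + 2 * X * g * k₀) * hC
    have := congrArg (aeval (uf K lam)) hpoly
    rw [map_add, map_sub, map_mul (aeval _) (k.comp _), ← smul_eq_C_mul (α : K),
      ← smul_eq_C_mul (α : K), map_smul, map_smul] at this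
    have hkh := congrArg (· * uh K lam) hk
    simp only [smul_mul_assoc] at hkh
    rw [map_add (aeval _) g, add_mul, mul_add]
    linear_combination (norm := module) this - hkh
  · rw [AlgEquiv.mul_apply, hs.2.1, map_add, ht.2.1, ht.map_aeval, add_assoc, ← map_add]
    congr 2
    simp
    ring
  · rw [AlgEquiv.mul_apply, hs.2.2, ht.map_aeval]
    congr 1
    simp
    ring

theorem IsTriangularU.unique {g k : K[X]} {α β : Kˣ} {t : ULam K lam ≃ₐ[K] ULam K lam}
    (h : IsTriangularU g α t) (h' : IsTriangularU k β t) : g = k ∧ α = β := by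
  constructor
  · have := aeval_uf_injective (add_left_cancel (h.2.1.symm.trans h'.2.1))
    exact mul_left_cancel₀ X_ne_zero (mul_left_cancel₀ two_ne_zero this)
  · have := aeval_uf_injective (h.2.2.symm.trans h'.2.2)
    exact Units.ext (inv_injective (C_injective (mul_right_cancel₀ X_ne_zero this)))

omit [IsAlgClosed K] [CharZero K] in
theorem IsTriangularU.inv {g : K[X]} {α : Kˣ} {t s : ULam K lam ≃ₐ[K] ULam K lam}
    (ht : IsTriangularU g α t)
    (hs : IsTriangularU (-(C (α : K) * g.comp (C (α : K) * X))) α⁻¹ s) :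
    IsTriangularU (-(C (α : K) * g.comp (C (α : K) * X))) α⁻¹ t⁻¹ := by
  have hC : (C (α : K)⁻¹ : K[X]) * C (α : K) = 1 := by
    rw [← C_mul, inv_mul_cancel₀ α.ne_zero, C_1]
  have hC' : (C (α : K) : K[X]) * (C (α : K)⁻¹ * X) = X := by
    rw [← mul_assoc, mul_comm (C _), hC, one_mul]
  have hts : IsTriangularU 0 1 (t * s) := by
    have := ht.mul hs
    simpa [comp_assoc, hC', ← mul_assoc, hC] using this
  have key : ∀ x, (t * s) x = x → t⁻¹ x = s x := fun x hx => t.injective <| by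
    rw [← AlgEquiv.mul_apply, mul_inv_cancel, AlgEquiv.one_apply, ← AlgEquiv.mul_apply, hx]
  obtain ⟨he, hh, hf⟩ := hts
  exact ⟨(key _ (by simpa using he)).trans hs.1, (key _ (by simpa using hh)).trans hs.2.1,
    (key _ (by simpa using hf)).trans hs.2.2⟩

end NormalForm

/-- Every element of `T′ = ⟨J′, H⟩ ⊆ Aut(U_λ)` can be written uniquely in
the form `e ↦ αe − αg(f)h − αf·g(f)² + αf·g′(f)`, `h ↦ h + 2f·g(f)`, `f ↦ α⁻¹f` with
`g ∈ K[x]`, `α ∈ Kˣ`. -/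
theorem triangularU_normal_form
    (δ : Polynomial K → (ULam K lam ≃ₐ[K] ULam K lam)) (hδ : ∀ g, IsDeltaU g (δ g))
    (HR : Kˣ → (ULam K lam ≃ₐ[K] ULam K lam)) (hHR : ∀ β, IsHRotU β (HR β)) :
    ∀ t ∈ Subgroup.closure (Set.range δ ∪ Set.range HR),
      ∃! p : Polynomial K × Kˣ,
        t (ue K lam) =
            (p.2 : K) • ue K lam -
              (p.2 : K) • (Polynomial.aeval (uf K lam) p.1 * uh K lam) -
              (p.2 : K) • (uf K lam * Polynomial.aeval (uf K lam) p.1 ^ 2) +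
              (p.2 : K) • (uf K lam * Polynomial.aeval (uf K lam) (Polynomial.derivative p.1)) ∧
        t (uh K lam) = uh K lam + 2 * (uf K lam * Polynomial.aeval (uf K lam) p.1) ∧
        t (uf K lam) = ((p.2 : K))⁻¹ • uf K lam := by
  open Polynomial in
  intro t ht
  simp only [← isTriangularU_iff]
  suffices h : ∃ g α, IsTriangularU g α t by
    obtain ⟨g, α, h⟩ := h
    exact ⟨(g, α), h, fun q hq => Prod.ext (hq.unique h).1 (hq.unique h).2⟩
  induction ht using Subgroup.closure_induction with
  | mem t ht =>
    rcases ht with ⟨g, rfl⟩ | ⟨β, rfl⟩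
    · exact ⟨g, 1, (hδ g).isTriangularU⟩
    · exact ⟨0, β, (hHR β).isTriangularU⟩
  | one => exact ⟨0, 1, by simp [isTriangularU_iff]⟩
  | mul t s _ _ iht ihs =>
    obtain ⟨g, α, hg⟩ := iht
    obtain ⟨k, β, hk⟩ := ihs
    exact ⟨_, _, hg.mul hk⟩
  | inv t _ iht =>
    obtain ⟨g, α, hg⟩ := iht
    refine ⟨_, _, hg.inv (s := δ (-(C (α : K) * g.comp (C (α : K) * X))) * HR α⁻¹) ?_⟩
    simpa using (hδ _).isTriangularU.mul (hHR α⁻¹).isTriangularU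
end
end
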